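/- arXiv:1806.02868 — 7 statements merged into one kernel-verified Lean document; each statement's English description precedes it below -/
import Mathlib

section
/- Let h : X → Y be a continuous semilattice homomorphism (i.e., h(a ⊓ b) = h(a) ⊓ h(b) for all a, b ∈ X) from a complete topologized semilattice X to a semitopological semilattice Y satisfying the separation axiom T⃗_{2δ}. Then the image h(X) is a closed subset of Y. -/
/-- A topological space satisfies the separation axiom `T_{2δ}` if it is `T₁` and for every
open set `U` and every point `x ∈ U` there exists a countable family of closed neighborhoods
of `x` whose intersection is contained in `U`. -/
def IsT2Delta (X : Type*) [TopologicalSpace X] : Prop :=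
  T1Space X ∧ ∀ U : Set X, IsOpen U → ∀ x ∈ U,
    ∃ 𝒰 : Set (Set X), 𝒰.Countable ∧ (∀ V ∈ 𝒰, IsClosed V ∧ V ∈ nhds x) ∧ ⋂₀ 𝒰 ⊆ U

/-- A topological space satisfies `T⃗_{2δ}` if it admits a continuous bijection onto a
`T_{2δ}`-space. -/
def IsVecT2Delta (X : Type u) [TopologicalSpace X] : Prop :=
  ∃ (Z : Type u) (tZ : TopologicalSpace Z) (f : X → Z),
    @Continuous X Z _ tZ f ∧ Function.Bijective f ∧ @IsT2Delta Z tZ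

/-- A topological space is functionally Hausdorff if distinct points are separated by a
continuous real-valued function. -/
def FunctionallyHausdorff (X : Type*) [TopologicalSpace X] : Prop :=
  ∀ x y : X, x ≠ y → ∃ f : X → ℝ, Continuous f ∧ f x ≠ f y

/-- `a` is a greatest lower bound of `C` within the subset `S`. -/
def IsGLBWithin {Y : Type*} [SemilatticeInf Y] (S C : Set Y) (a : Y) : Prop :=
  a ∈ S ∧ (∀ c ∈ C, a ≤ c) ∧ ∀ b ∈ S, (∀ c ∈ C, b ≤ c) → b ≤ a

/-- `a` is a least upper bound of `C` within the subset `S`. -/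
def IsLUBWithin {Y : Type*} [SemilatticeInf Y] (S C : Set Y) (a : Y) : Prop :=
  a ∈ S ∧ (∀ c ∈ C, c ≤ a) ∧ ∀ b ∈ S, (∀ c ∈ C, c ≤ b) → a ≤ b

/-- A topologized semilattice is complete if every nonempty chain has an infimum and a
supremum, both belonging to the closure of the chain. -/
def IsCompleteTopSemilattice (X : Type*) [SemilatticeInf X] [TopologicalSpace X] : Prop :=
  ∀ C : Set X, C.Nonempty → IsChain (· ≤ ·) C →
    (∃ a ∈ closure C, IsGLB C a) ∧ ∃ b ∈ closure C, IsLUB C b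

/-- A subsemilattice `X` of a topologized semilattice `Y` is complete (in the subspace
topology and induced order) if every nonempty chain `C ⊆ X` has a greatest lower bound and
a least upper bound within `X`, both belonging to the closure of `C`. -/
def IsCompleteSubSemilattice {Y : Type*} [SemilatticeInf Y] [TopologicalSpace Y]
    (X : Set Y) : Prop :=
  ∀ C : Set Y, C ⊆ X → C.Nonempty → IsChain (· ≤ ·) C →
    (∃ a ∈ closure C, IsGLBWithin X C a) ∧ ∃ b ∈ closure C, IsLUBWithin X C b

/-- Choice along a well-founded relation: a witness `x i` is picked whenever one exists, the
requirement on it depending only on the values of `x` strictly below `i`. -/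
theorem exists_wellFounded_choice {ι : Type*} [Preorder ι] [WellFoundedLT ι] {X : Type*}
    [Nonempty X] (R : ι → (ι → X) → X → Prop)
    (hR : ∀ i x x' z, (∀ j < i, x j = x' j) → R i x z → R i x' z) :
    ∃ x : ι → X, ∀ i, (∃ z, R i x z) → R i x (x i) := by
  classical
  let ext (i : ι) (p : ∀ j, j < i → X) : ι → X :=
    fun j => if hj : j < i then p j hj else Classical.arbitrary X
  let F (i : ι) (p : ∀ j, j < i → X) : X := Classical.epsilon (R i (ext i p))
  let x : ι → X := (wellFounded_lt (α := ι)).fix F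
  have hx (i : ι) : x i = F i fun j _ => x j := WellFounded.fix_eq _ F i
  refine ⟨x, fun i hi => ?_⟩
  have hext : ∀ j < i, ext i (fun j _ => x j) j = x j := fun j hj => dif_pos hj
  rw [hx]
  refine hR i _ _ _ hext (Classical.epsilon_spec ?_)
  obtain ⟨z, hz⟩ := hi
  exact ⟨z, hR i _ _ z (fun j hj => (hext j hj).symm) hz⟩

namespace IsCompleteTopSemilattice

variable {X : Type*} [SemilatticeInf X] [TopologicalSpace X]

theorem mem_closure_of_isGLB (hX : IsCompleteTopSemilattice X) {C : Set X} (hne : C.Nonempty)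
    (hC : IsChain (· ≤ ·) C) {a : X} (ha : IsGLB C a) : a ∈ closure C := by
  obtain ⟨⟨b, hb, hb'⟩, -⟩ := hX C hne hC
  rwa [ha.unique hb']

theorem mem_closure_of_isLUB (hX : IsCompleteTopSemilattice X) {C : Set X} (hne : C.Nonempty)
    (hC : IsChain (· ≤ ·) C) {a : X} (ha : IsLUB C a) : a ∈ closure C := by
  obtain ⟨-, b, hb, hb'⟩ := hX C hne hC
  rwa [ha.unique hb']

theorem exists_isGLB_range (hX : IsCompleteTopSemilattice X) {ι : Type*} [Nonempty ι]
    (x : ι → X) : ∃ a, IsGLB (Set.range x) a := by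
  have : Nonempty X := ‹Nonempty ι›.map x
  obtain ⟨_, _⟩ := exists_wellFoundedLT ι
  have chain_of (J : ι → X) (s : Set ι) (hJ : ∀ t ∈ s, IsGLB (x '' Set.Iic t) (J t)) :
      IsChain (· ≤ ·) (J '' s) := by
    have anti : ∀ t ∈ s, ∀ t' ∈ s, t ≤ t' → J t' ≤ J t := fun t ht t' ht' h =>
      (hJ t ht).mono (hJ t' ht') (Set.image_mono (Set.Iic_subset_Iic.2 h))
    rintro _ ⟨t, ht, rfl⟩ _ ⟨t', ht', rfl⟩ -
    rcases le_total t t' with h | h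
    · exact Or.inr (anti t ht t' ht' h)
    · exact Or.inl (anti t' ht' t ht h)
  have key (t : ι) : ∃ a, IsGLB (x '' Set.Iic t) a := by
    induction t using WellFoundedLT.induction with
    | ind t ih =>
      choose! J hJ using ih
      rcases (Set.Iio t).eq_empty_or_nonempty with he | hne
      · refine ⟨x t, ?_⟩
        rw [← Set.Iio_insert, he]
        simp
      · obtain ⟨⟨a, -, ha⟩, -⟩ := hX (J '' Set.Iio t) (hne.image _) (chain_of J _ hJ)
        refine ⟨a ⊓ x t, ?_, ?_⟩
        · rintro _ ⟨s, hs, rfl⟩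
          rcases (Set.mem_Iic.1 hs).lt_or_eq with hlt | rfl
          · exact inf_le_left.trans ((ha.1 ⟨s, hlt, rfl⟩).trans ((hJ s hlt).1 ⟨s, le_rfl, rfl⟩))
          · exact inf_le_right
        · intro b hb
          refine le_inf (ha.2 ?_) (hb ⟨t, le_rfl, rfl⟩)
          rintro _ ⟨s, hs, rfl⟩
          exact (hJ s hs).2 fun c hc =>
            hb (Set.image_mono (Set.Iic_subset_Iic.2 (le_of_lt hs)) hc)
  choose J hJ using key
  obtain ⟨⟨a, -, ha⟩, -⟩ := hX (J '' Set.univ) (Set.univ_nonempty.image J)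
    (chain_of J _ fun t _ => hJ t)
  refine ⟨a, ?_, fun b hb => ha.2 ?_⟩
  · rintro _ ⟨t, rfl⟩
    exact (ha.1 ⟨t, trivial, rfl⟩).trans ((hJ _).1 ⟨t, le_rfl, rfl⟩)
  · rintro _ ⟨t, -, rfl⟩
    refine (hJ t).2 ?_
    rintro _ ⟨s, -, rfl⟩
    exact hb ⟨s, rfl⟩

theorem exists_isGLB (hX : IsCompleteTopSemilattice X) {T : Set X} (hT : T.Nonempty) :
    ∃ a, IsGLB T a := by
  have := hT.to_subtype
  simpa using hX.exists_isGLB_range (Subtype.val : T → X)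

/-- Given a decreasing well-ordered family of sets `A i`, a transfinite sequence in `X` all of
whose finite and infinite segments have infimum in the appropriate `A i` yields a point of
`⋂ i, closure (A i)`. -/
theorem exists_mem_closure {Y : Type*} [SemilatticeInf Y] [TopologicalSpace Y]
    (hX : IsCompleteTopSemilattice X) [Nonempty X] {h : X → Y} (hc : Continuous h)
    (hhom : ∀ a b : X, h (a ⊓ b) = h a ⊓ h b) {y : Y} (hy : Continuous fun z => z ⊓ y)
    {ι : Type*} [LinearOrder ι] [WellFoundedLT ι] [Nonempty ι] {A : ι → Set Y} (hA : Antitone A)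
    (hlim : ∀ i j : ι, IsClosed (A i) ∨ (Set.Iio j).Finite)
    (hex : ∀ (i : ι) (p : ι → Y), (∀ j < i, p j ⊓ y ∈ A j) →
      ∃ z : X, (h z ∈ A i ∧ h z ⊓ y ∈ A i) ∧
        ∀ j < i, p j ⊓ h z ∈ A j ∧ p j ⊓ h z ⊓ y ∈ A j) :
    ∃ x : X, ∀ i, h x ∈ closure (A i) := by
  classical
  have hg : ∀ T : Set X, ∃ a, T.Nonempty → IsGLB T a := fun T => by
    by_cases hT : T.Nonempty
    · exact (hX.exists_isGLB hT).imp fun a ha _ => ha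
    · exact ⟨Classical.arbitrary X, fun h => absurd h hT⟩
  choose g hg using hg
  obtain ⟨x, hx⟩ := exists_wellFounded_choice
    (fun (i : ι) (x : ι → X) (z : X) => (h z ∈ A i ∧ h z ⊓ y ∈ A i) ∧
      ∀ j < i, h (g (x '' Set.Ico j i)) ⊓ h z ∈ A j ∧ h (g (x '' Set.Ico j i)) ⊓ h z ⊓ y ∈ A j)
    (by
      rintro i x x' z hxx ⟨h₁, h₂⟩
      refine ⟨h₁, fun j hj => ?_⟩
      rw [← Set.image_congr fun k (hk : k ∈ Set.Ico j i) => hxx k hk.2]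
      exact h₂ j hj)
  have hJ (j i : ι) (hji : j ≤ i) : IsGLB (x '' Set.Icc j i) (g (x '' Set.Icc j i)) :=
    hg _ ((Set.nonempty_Icc.2 hji).image x)
  have chain (j : ι) (s : Set ι) (hs : s ⊆ Set.Ici j) :
      IsChain (· ≤ ·) ((fun k => g (x '' Set.Icc j k)) '' s) := by
    have anti : ∀ k ∈ s, ∀ k' ∈ s, k ≤ k' → g (x '' Set.Icc j k') ≤ g (x '' Set.Icc j k) :=
      fun k hk k' hk' hkk => (hJ j k (hs hk)).mono (hJ j k' (hs hk'))
        (Set.image_mono (Set.Icc_subset_Icc_right hkk))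
    rintro _ ⟨k, hk, rfl⟩ _ ⟨k', hk', rfl⟩ -
    rcases le_total k k' with hkk | hkk
    · exact Or.inr (anti k hk k' hk' hkk)
    · exact Or.inl (anti k' hk' k hk hkk)
  have glb (j : ι) (s : Set ι) (hne : s.Nonempty) (hs : s ⊆ Set.Ici j)
      (hs' : ∀ k ∈ s, Set.Icc j k ⊆ s) :
      IsGLB ((fun k => g (x '' Set.Icc j k)) '' s) (g (x '' s)) := by
    have hs0 := hg _ (hne.image x)
    constructor
    · rintro _ ⟨k, hk, rfl⟩
      exact (hJ j k (hs hk)).mono hs0 (Set.image_mono (hs' k hk))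
    · intro b hb
      refine hs0.2 ?_
      rintro _ ⟨k, hk, rfl⟩
      exact (hb ⟨k, hk, rfl⟩).trans ((hJ j k (hs hk)).1 ⟨k, ⟨hs hk, le_rfl⟩, rfl⟩)
  have inv (i : ι) : ∀ j ≤ i, h (g (x '' Set.Icc j i)) ∈ A j ∧
      h (g (x '' Set.Icc j i)) ⊓ y ∈ A j := by
    induction i using WellFoundedLT.induction with
    | ind i ih =>
      have hI : ∀ j < i, h (g (x '' Set.Ico j i)) ⊓ y ∈ A j := by
        intro j hj
        have hne : (Set.Ico j i).Nonempty := Set.nonempty_Ico.2 hj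
        have hglb := glb j (Set.Ico j i) hne (fun k hk => hk.1)
          (fun k hk l hl => ⟨hl.1, hl.2.trans_lt hk.2⟩)
        have hch := chain j (Set.Ico j i) (fun k hk => hk.1)
        have hmem : ∀ a ∈ (fun k => g (x '' Set.Icc j k)) '' Set.Ico j i, h a ⊓ y ∈ A j := by
          rintro _ ⟨k, hk, rfl⟩
          exact (ih k hk.2 j hk.1).2
        rcases hlim j i with hcl | hfin
        · exact closure_minimal hmem (hcl.preimage (hy.comp hc))
            (hX.mem_closure_of_isGLB (hne.image _) hch hglb)
        · have hfin' : ((fun k => g (x '' Set.Icc j k)) '' Set.Ico j i).Finite :=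
            (hfin.subset fun k hk => hk.2).image _
          obtain ⟨m, hm, hmin⟩ := hfin'.exists_minimal (hne.image _)
          have hleast : IsLeast ((fun k => g (x '' Set.Icc j k)) '' Set.Ico j i) m :=
            ⟨hm, fun b hb => (hch.total hm hb).elim id fun hbm => hmin hb hbm⟩
          rw [hglb.unique hleast.isGLB]
          exact hmem m hm
      obtain ⟨h₁, h₂⟩ := hx i (hex i (fun j => h (g (x '' Set.Ico j i))) hI)
      intro j hj
      rcases hj.lt_or_eq with hlt | rfl
      · have hEq : g (x '' Set.Icc j i) = g (x '' Set.Ico j i) ⊓ x i := by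
          refine (hJ j i hj).unique ?_
          rw [← Set.Ico_insert_right hj, Set.image_insert_eq, inf_comm]
          exact (hg _ ((Set.nonempty_Ico.2 hlt).image x)).insert _
        rw [hEq, hhom]
        exact h₂ j hlt
      · have hEq : g (x '' Set.Icc j j) = x j := by
          refine (hJ j j le_rfl).unique ?_
          simp
        rw [hEq]
        exact h₁
  let t (i : ι) : X := g (x '' Set.Ici i)
  have ht (i : ι) : h (t i) ∈ closure (A i) := by
    have := hX.mem_closure_of_isGLB (Set.nonempty_Ici.image _) (chain i (Set.Ici i) subset_rfl)
      (glb i (Set.Ici i) Set.nonempty_Ici subset_rfl fun k _ l hl => hl.1)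
    refine closure_minimal ?_ (isClosed_closure.preimage hc) this
    rintro _ ⟨k, hk, rfl⟩
    exact subset_closure (inv k i hk).1
  have tmono : Monotone t := fun i j hij =>
    (hg _ (Set.nonempty_Ici.image x)).mono (hg _ (Set.nonempty_Ici.image x))
      (Set.image_mono (Set.Ici_subset_Ici.2 hij))
  have tchain (s : Set ι) : IsChain (· ≤ ·) (t '' s) := by
    rintro _ ⟨i, -, rfl⟩ _ ⟨j, -, rfl⟩ -
    exact (le_total i j).imp (fun h => tmono h) fun h => tmono h
  obtain ⟨-, s, -, hs⟩ := hX (t '' Set.univ) (Set.univ_nonempty.image t) (tchain _)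
  refine ⟨s, fun i => ?_⟩
  have hs' : IsLUB (t '' Set.Ici i) s := by
    refine ⟨fun a ha => hs.1 (Set.image_mono (Set.subset_univ _) ha), fun b hb => hs.2 ?_⟩
    rintro _ ⟨j, -, rfl⟩
    exact (tmono (le_max_left j i)).trans (hb ⟨max j i, le_max_right j i, rfl⟩)
  refine closure_minimal ?_ (isClosed_closure.preimage hc)
    (hX.mem_closure_of_isLUB (Set.nonempty_Ici.image t) (tchain _) hs')
  rintro _ ⟨j, hj, rfl⟩
  exact closure_mono (hA hj) (ht j)

end IsCompleteTopSemilattice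

/-- A set which is the intersection of a sequence of open sets and also the intersection of
their closures. -/
def IsClosedGδ {Y : Type*} [TopologicalSpace Y] (G : Set Y) : Prop :=
  ∃ U : ℕ → Set Y, (∀ n, IsOpen (U n)) ∧ G ⊆ ⋂ n, U n ∧ ⋂ n, closure (U n) ⊆ G

namespace IsClosedGδ

variable {Y Z : Type*} [TopologicalSpace Y] [TopologicalSpace Z]

theorem isClosed {G : Set Y} (hG : IsClosedGδ G) : IsClosed G := by
  obtain ⟨U, -, h₁, h₂⟩ := hG
  have : G = ⋂ n, closure (U n) :=
    (h₁.trans (Set.iInter_mono fun n => subset_closure)).antisymm h₂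
  rw [this]
  exact isClosed_iInter fun n => isClosed_closure

theorem preimage {G : Set Z} (hG : IsClosedGδ G) {f : Y → Z} (hf : Continuous f) :
    IsClosedGδ (f ⁻¹' G) := by
  obtain ⟨U, ho, h₁, h₂⟩ := hG
  refine ⟨fun n => f ⁻¹' U n, fun n => (ho n).preimage hf, ?_, ?_⟩
  · rw [← Set.preimage_iInter]
    exact Set.preimage_mono h₁
  · refine (Set.iInter_mono fun n => hf.closure_preimage_subset (U n)).trans ?_
    rw [← Set.preimage_iInter]
    exact Set.preimage_mono h₂

end IsClosedGδ

theorem IsT2Delta.exists_isClosedGδ {Z : Type*} [TopologicalSpace Z] (hZ : IsT2Delta Z)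
    {U : Set Z} (hU : IsOpen U) {z : Z} (hz : z ∈ U) :
    ∃ G, IsClosedGδ G ∧ z ∈ G ∧ G ⊆ U := by
  have step (W : {W : Set Z // IsOpen W ∧ z ∈ W}) :
      ∃ V : ℕ → {W : Set Z // IsOpen W ∧ z ∈ W}, ⋂ n, closure (V n).1 ⊆ W.1 := by
    obtain ⟨𝒰, hcount, h𝒰, hsub⟩ := hZ.2 W.1 W.2.1 z W.2.2
    obtain ⟨f, hf⟩ := (hcount.insert Set.univ).exists_eq_range (Set.insert_nonempty _ _)
    have hfn (n : ℕ) : IsClosed (f n) ∧ f n ∈ nhds z := by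
      rcases (hf ▸ Set.mem_range_self n : f n ∈ insert Set.univ 𝒰) with h | h
      · rw [h]
        exact ⟨isClosed_univ, Filter.univ_mem⟩
      · exact h𝒰 _ h
    refine ⟨fun n => ⟨interior (f n), isOpen_interior, mem_interior_iff_mem_nhds.2 (hfn n).2⟩,
      fun w hw => hsub fun V hV => ?_⟩
    obtain ⟨n, rfl⟩ : V ∈ Set.range f := hf ▸ Set.mem_insert_of_mem _ hV
    exact closure_minimal interior_subset (hfn n).1 (Set.mem_iInter.1 hw n)
  choose V hV using step
  let T (l : List ℕ) : {W : Set Z // IsOpen W ∧ z ∈ W} :=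
    l.rec ⟨U, hU, hz⟩ fun n _ W => V W n
  have hT : ⋂ l, closure (T l).1 ⊆ ⋂ l, (T l).1 := fun w hw => Set.mem_iInter.2 fun l =>
    hV (T l) (Set.mem_iInter.2 fun n => Set.mem_iInter.1 hw (n :: l))
  let e := Denumerable.eqv (List ℕ)
  refine ⟨⋂ l, (T l).1, ⟨fun n => (T (e.symm n)).1, fun n => (T _).2.1, ?_, ?_⟩,
    Set.mem_iInter.2 fun l => (T l).2.2, fun w hw => Set.mem_iInter.1 hw []⟩
  · exact fun w hw => Set.mem_iInter.2 fun n => Set.mem_iInter.1 hw _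
  · refine fun w hw => hT (Set.mem_iInter.2 fun l => ?_)
    simpa using Set.mem_iInter.1 hw (e l)

theorem IsVecT2Delta.exists_isClosedGδ {Y : Type u} [TopologicalSpace Y] (hY : IsVecT2Delta Y)
    {y y' : Y} (hne : y' ≠ y) : ∃ G, IsClosedGδ G ∧ y ∈ G ∧ y' ∉ G := by
  obtain ⟨Z, tZ, f, hf, hbij, hZ⟩ := hY
  have := hZ.1
  obtain ⟨G, hG, hyG, hGU⟩ := hZ.exists_isClosedGδ (isOpen_compl_singleton (x := f y'))
    (z := f y) fun h => hne (hbij.1 h).symm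
  exact ⟨f ⁻¹' G, hG.preimage hf, hyG, fun h => hGU h rfl⟩

/-- A point in the closure of the image of a complete topologized semilattice cannot be separated
from this image by any intersection of closed `Gδ`-sets containing that point. -/
theorem IsCompleteTopSemilattice.exists_forall_mem {X Y : Type*} [SemilatticeInf X]
    [TopologicalSpace X] [SemilatticeInf Y] [TopologicalSpace Y]
    (hX : IsCompleteTopSemilattice X) (hYsemi : ∀ a : Y, Continuous fun y => a ⊓ y)
    {h : X → Y} (hc : Continuous h) (hhom : ∀ a b : X, h (a ⊓ b) = h a ⊓ h b)
    {y : Y} (hy : y ∈ closure (Set.range h)) {ι : Type*} (G : ι → Set Y)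
    (hG : ∀ i, IsClosedGδ (G i)) (hyG : ∀ i, y ∈ G i) : ∃ x, ∀ i, h x ∈ G i := by
  have : Nonempty X := Set.range_nonempty_iff_nonempty.1 (closure_nonempty_iff.1 ⟨y, hy⟩)
  have hYr (a : Y) : Continuous fun z => z ⊓ a := by simpa only [inf_comm] using hYsemi a
  induction hκ : Cardinal.mk ι using WellFoundedLT.induction generalizing ι with
  | ind κ ih =>
    subst hκ
    rcases le_or_gt (Cardinal.mk ι) Cardinal.aleph0 with hle | hlt
    · rcases isEmpty_or_nonempty ι with hι | hι
      · exact ⟨Classical.arbitrary X, fun i => isEmptyElim i⟩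
      have : Countable ι := Cardinal.mk_le_aleph0_iff.1 hle
      choose U hUo hGU hUG using hG
      obtain ⟨e, he⟩ := exists_surjective_nat (ι × ℕ)
      let W (n : ℕ) : Set Y := U (e n).1 (e n).2
      have hW (n : ℕ) : IsOpen (W n) := hUo _ _
      have hyW (n : ℕ) : y ∈ W n := Set.mem_iInter.1 (hGU _ (hyG _)) _
      let A (n : ℕ) : Set Y := ⋂ k ∈ Set.Iic n, W k
      have hAo (n : ℕ) : IsOpen (A n) := (Set.finite_Iic n).isOpen_biInter fun k _ => hW k
      have hyA (n : ℕ) : y ∈ A n := Set.mem_iInter₂.2 fun k _ => hyW k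
      obtain ⟨x, hx⟩ := hX.exists_mem_closure hc hhom (hYr y) (A := A)
        (fun m n hmn => Set.biInter_subset_biInter_left (Set.Iic_subset_Iic.2 hmn))
        (fun _ n => Or.inr (Set.finite_Iio n)) (by
          intro i p hp
          have hopen : IsOpen ((A i ∩ (fun z => z ⊓ y) ⁻¹' A i) ∩
              ⋂ j ∈ Set.Iio i, ((fun z => p j ⊓ z) ⁻¹' A j ∩
                (fun z => p j ⊓ z ⊓ y) ⁻¹' A j)) :=
            ((hAo i).inter ((hAo i).preimage (hYr y))).inter
              ((Set.finite_Iio i).isOpen_biInter fun j _ =>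
                ((hAo j).preimage (hYsemi _)).inter
                  ((hAo j).preimage ((hYr y).comp (hYsemi (p j)))))
          obtain ⟨_, hz, z, rfl⟩ := mem_closure_iff.1 hy _ hopen (by
            refine ⟨⟨hyA i, by simpa using hyA i⟩, Set.mem_iInter₂.2 fun j hj => ⟨hp j hj, ?_⟩⟩
            simpa [inf_assoc] using hp j hj)
          exact ⟨z, hz.1, fun j hj => Set.mem_iInter₂.1 hz.2 j hj⟩)
      refine ⟨x, fun i => hUG i (Set.mem_iInter.2 fun n => ?_)⟩
      obtain ⟨k, hk⟩ := he (i, n)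
      have hAk : A k ⊆ U i n := fun w hw => by
        simpa [W, hk] using Set.mem_iInter₂.1 hw k (Set.mem_Iic.2 le_rfl)
      exact closure_mono hAk (hx k)
    · obtain ⟨_, _, hord⟩ := Cardinal.exists_ord_eq_type_lt ι
      have : Nonempty ι := Cardinal.mk_ne_zero_iff.1 (Cardinal.aleph0_pos.trans hlt).ne'
      have hIio (i : ι) : Cardinal.mk (Set.Iio i) < Cardinal.mk ι :=
        Cardinal.mk_Iio_lt i hord
      have hOpt (i : ι) : Cardinal.mk (Option (Set.Iio i)) < Cardinal.mk ι := by
        rw [Cardinal.mk_option]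
        exact Cardinal.add_lt_of_lt hlt.le (hIio i) (Cardinal.one_lt_aleph0.trans hlt)
      have hIic (i : ι) : Cardinal.mk (Set.Iic i) < Cardinal.mk ι := by
        rw [← Set.Iio_insert]
        exact Cardinal.mk_insert_le.trans_lt
          (Cardinal.add_lt_of_lt hlt.le (hIio i) (Cardinal.one_lt_aleph0.trans hlt))
      have hBool : Cardinal.mk (ULift Bool) < Cardinal.mk ι :=
        (Cardinal.lt_aleph0_of_finite _).trans hlt
      let A (i : ι) : Set Y := ⋂ k ∈ Set.Iic i, G k
      have hAc (i : ι) : IsClosed (A i) := isClosed_biInter fun k _ => (hG k).isClosed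
      have hA {i : ι} {w : Y} (hw : w ∈ A i) (k : ι) (hk : k ≤ i) : w ∈ G k :=
        Set.mem_iInter₂.1 hw k hk
      obtain ⟨x, hx⟩ := hX.exists_mem_closure hc hhom (hYr y) (A := A)
        (fun m n hmn => Set.biInter_subset_biInter_left (Set.Iic_subset_Iic.2 hmn))
        (fun i _ => Or.inl (hAc i)) (by
          intro i p hp
          let f (o : Option (Set.Iio i)) (z : Y) : Y := o.elim z fun j => p j ⊓ z
          have hf (o : Option (Set.Iio i)) : Continuous (f o) := by
            cases o with
            | none => exact continuous_id
            | some j => exact hYsemi _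
          let φ (o : Option (Set.Iio i)) (b : Bool) (z : Y) : Y := cond b (f o z ⊓ y) (f o z)
          have hφ (o : Option (Set.Iio i)) (b : Bool) : Continuous (φ o b) := by
            cases b with
            | false => exact hf o
            | true => exact (hYr y).comp (hf o)
          let m (o : Option (Set.Iio i)) (k : ι) : ι := o.elim k fun j => min k j
          obtain ⟨z, hz⟩ := ih _ (Cardinal.mul_lt_of_lt hlt.le (hOpt i)
              (Cardinal.mul_lt_of_lt hlt.le (hIic i) hBool))
            (fun q : Option (Set.Iio i) × Set.Iic i × ULift Bool =>
              φ q.1 q.2.2.down ⁻¹' G (m q.1 q.2.1))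
            (fun q => (hG _).preimage (hφ _ _))
            (by
              rintro ⟨o, k, b⟩
              have hfy : f o y ∈ G (m o k) ∧ f o y ⊓ y = f o y := by
                cases o with
                | none => exact ⟨hyG _, inf_idem y⟩
                | some j => exact ⟨hA (hp j j.2) _ (min_le_right _ _), by simp [f]⟩
              rcases b with ⟨_ | _⟩
              · exact hfy.1
              · exact Set.mem_preimage.2 (hfy.2.symm ▸ hfy.1 : f o y ⊓ y ∈ G (m o k)))
            (by simp)
          refine ⟨z, ⟨?_, ?_⟩, fun j hj => ⟨?_, ?_⟩⟩
          · exact Set.mem_iInter₂.2 fun k hk => hz (none, ⟨k, hk⟩, ⟨false⟩)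
          · exact Set.mem_iInter₂.2 fun k hk => hz (none, ⟨k, hk⟩, ⟨true⟩)
          · refine Set.mem_iInter₂.2 fun k hk => ?_
            have hzk := hz (some ⟨j, hj⟩, ⟨k, (Set.mem_Iic.1 hk).trans hj.le⟩, ⟨false⟩)
            rwa [show m (some ⟨j, hj⟩) k = k from min_eq_left hk] at hzk
          · refine Set.mem_iInter₂.2 fun k hk => ?_
            have hzk := hz (some ⟨j, hj⟩, ⟨k, (Set.mem_Iic.1 hk).trans hj.le⟩, ⟨true⟩)
            rwa [show m (some ⟨j, hj⟩) k = k from min_eq_left hk] at hzk)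
      exact ⟨x, fun i => hA ((hAc i).closure_eq ▸ hx i) i le_rfl⟩

/-- the continuous homomorphic image of a complete topologized semilattice in a
semitopological semilattice satisfying `T⃗_{2δ}` is closed. -/
theorem stmt0 {X Y : Type u} [SemilatticeInf X] [TopologicalSpace X]
    [SemilatticeInf Y] [TopologicalSpace Y]
    (hX : IsCompleteTopSemilattice X)
    (hYsemi : ∀ a : Y, Continuous fun y => a ⊓ y)
    (hY : IsVecT2Delta Y)
    (h : X → Y) (hc : Continuous h) (hhom : ∀ a b : X, h (a ⊓ b) = h a ⊓ h b) :
    IsClosed (Set.range h) := by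
  refine isClosed_of_closure_subset fun y hy => ?_
  obtain ⟨x, hx⟩ := hX.exists_forall_mem hYsemi hc hhom hy
    (fun G : {G : Set Y // IsClosedGδ G ∧ y ∈ G} => G.1) (fun G => G.2.1) fun G => G.2.2
  refine ⟨x, by_contra fun hne => ?_⟩
  obtain ⟨G, hG, hyG, hxG⟩ := hY.exists_isClosedGδ hne
  exact hxG (hx ⟨G, hG, hyG⟩)
end

section
/- Let h : X → Y be a continuous semilattice homomorphism (i.e., h(a ⊓ b) = h(a) ⊓ h(b) for all a, b ∈ X) from a complete topologized semilattice X to a functionally Hausdorff semitopological semilattice Y. Then the image h(X) is a closed subset of Y. -/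
/-- In a semilattice whose nonempty chains have greatest lower bounds, every nonempty set has
a greatest lower bound. -/
theorem exists_isGLB_of_chains {X : Type*} [SemilatticeInf X]
    (hX : ∀ C : Set X, C.Nonempty → IsChain (· ≤ ·) C → ∃ a, IsGLB C a)
    {A : Set X} (hA : A.Nonempty) : ∃ a, IsGLB A a := by
  obtain ⟨a₀, ha₀⟩ := hA
  obtain ⟨m, -, hm⟩ := zorn_le_nonempty₀ (α := Xᵒᵈ)
    {z | ∀ l ∈ lowerBounds A, l ≤ OrderDual.ofDual z}
    (by
      intro C hC hchain z hz
      obtain ⟨a, ha⟩ := hX (OrderDual.ofDual ⁻¹' C : Set Xᵒᵈ) ⟨z, hz⟩ hchain.symm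
      exact ⟨OrderDual.toDual a, fun l hl => ha.2 fun c hc => hC hc l hl, fun c hc => ha.1 hc⟩)
    (OrderDual.toDual a₀) (fun l hl => hl ha₀)
  refine ⟨OrderDual.ofDual m, fun a ha => ?_, hm.prop⟩
  have hmem : OrderDual.toDual (OrderDual.ofDual m ⊓ a) ∈
      {z : Xᵒᵈ | ∀ l ∈ lowerBounds A, l ≤ OrderDual.ofDual z} :=
    fun l hl => le_inf (hm.prop l hl) (hl ha)
  have := hm.2 hmem (inf_le_left : OrderDual.ofDual m ⊓ a ≤ OrderDual.ofDual m)
  exact (show OrderDual.ofDual m ≤ OrderDual.ofDual m ⊓ a from this).trans inf_le_right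

/-- A point approximating all members of a well-ordered decreasing family of sets, obtained by
transfinite recursion as a limit inferior. -/
theorem IsCompleteTopSemilattice.exists_mem_closure_s1 {X ι : Type*} [SemilatticeInf X]
    [TopologicalSpace X] [Nonempty X] (hX : IsCompleteTopSemilattice X)
    [LinearOrder ι] [WellFoundedLT ι] [Nonempty ι] {A : ι → Set X} (hA : Antitone A)
    (hinf : ∀ α β (v : ι → X) (c : X), α < β → AntitoneOn v (Set.Ico α β) →
      (∀ γ ∈ Set.Ico α β, v γ ∈ A α) → IsGLB (v '' Set.Ico α β) c → c ∈ A α)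
    (hstep : ∀ β (w : ι → X), (∀ α < β, w α ∈ A α) →
      ∃ x ∈ A β, ∀ α < β, w α ⊓ x ∈ A α) :
    ∃ c, ∀ α, c ∈ closure (A α) := by
  have hglb : ∀ B : Set X, ∃ a, B.Nonempty → IsGLB B a := fun B => by
    by_cases hB : B.Nonempty
    · obtain ⟨a, ha⟩ := exists_isGLB_of_chains
        (fun C hC hC' => (hX C hC hC').1.imp fun _ h => h.2) hB
      exact ⟨a, fun _ => ha⟩
    · exact ⟨Classical.arbitrary X, fun h => (hB h).elim⟩
  choose m hm using hglb
  obtain ⟨x, hx⟩ : ∃ x : ι → X, ∀ β, (∀ α < β, m (x '' Set.Ico α β) ∈ A α) →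
      x β ∈ A β ∧ ∀ α < β, m (x '' Set.Ico α β) ⊓ x β ∈ A α := by
    let F : ∀ β : ι, (∀ γ, γ < β → X) → X := fun β xs =>
      Classical.epsilon fun z => z ∈ A β ∧
        ∀ α < β, m {u | ∃ γ, ∃ h : γ < β, α ≤ γ ∧ xs γ h = u} ⊓ z ∈ A α
    let x : ι → X := (wellFounded_lt (α := ι)).fix F
    have himage : ∀ α β, {u | ∃ γ, ∃ _ : γ < β, α ≤ γ ∧ x γ = u} = x '' Set.Ico α β := by
      intro α β
      ext u
      simp only [Set.mem_ofPred_eq, Set.mem_image, Set.mem_Ico]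
      grind
    refine ⟨x, fun β hβ => ?_⟩
    have hxβ : x β = Classical.epsilon fun z => z ∈ A β ∧
        ∀ α < β, m (x '' Set.Ico α β) ⊓ z ∈ A α := by
      have h := (wellFounded_lt (α := ι)).fix_eq F β
      simp only [← himage]
      exact h
    obtain ⟨z, hz⟩ := hstep β (fun α => m (x '' Set.Ico α β)) hβ
    have := Classical.epsilon_spec (p := fun z => z ∈ A β ∧
        ∀ α < β, m (x '' Set.Ico α β) ⊓ z ∈ A α) ⟨z, hz⟩
    rwa [← hxβ] at this
  have hIcc : ∀ α γ, α ≤ γ → IsGLB (x '' Set.Icc α γ) (m (x '' Set.Icc α γ)) :=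
    fun α γ h => hm _ ((Set.nonempty_Icc.2 h).image x)
  have hanti : ∀ α, AntitoneOn (fun γ => m (x '' Set.Icc α γ)) (Set.Ici α) :=
    fun α γ hγ δ hδ hγδ => (hIcc α γ hγ).mono (hIcc α δ hδ)
      (Set.image_mono (Set.Icc_subset_Icc_right hγδ))
  -- the infimum over an initial part of `[α, ∞)` is the infimum of the partial infima
  have hparts : ∀ α (S : Set ι), S ⊆ Set.Ici α → (∀ γ ∈ S, Set.Icc α γ ⊆ S) → S.Nonempty →
      IsGLB ((fun γ => m (x '' Set.Icc α γ)) '' S) (m (x '' S)) := by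
    intro α S hS hS' hne
    have h := hm _ (hne.image x)
    constructor
    · rintro _ ⟨γ, hγ, rfl⟩
      exact (hIcc α γ (hS hγ)).mono h (Set.image_mono (hS' γ hγ))
    · intro l hl
      refine h.2 ?_
      rintro _ ⟨γ, hγ, rfl⟩
      exact (hl ⟨γ, hγ, rfl⟩).trans
        ((hIcc α γ (hS hγ)).1 ⟨γ, Set.right_mem_Icc.2 (hS hγ), rfl⟩)
  have hmem : ∀ β, ∀ α ≤ β, m (x '' Set.Icc α β) ∈ A α := by
    intro β
    induction β using WellFoundedLT.induction with
    | ind β ih =>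
      obtain ⟨hβ, hβ'⟩ := hx β fun α hα =>
        hinf α β (fun γ => m (x '' Set.Icc α γ)) _ hα ((hanti α).mono Set.Ico_subset_Ici_self)
          (fun γ hγ => ih γ hγ.2 α hγ.1)
          (hparts α _ Set.Ico_subset_Ici_self
            (fun γ hγ δ hδ => ⟨hδ.1, hδ.2.trans_lt hγ.2⟩) (Set.nonempty_Ico.2 hα))
      intro α hα
      rcases hα.eq_or_lt with rfl | hlt
      · have : m (x '' Set.Icc α α) = x α := by
          have h := hIcc α α le_rfl
          rw [Set.Icc_self, Set.image_singleton] at h ⊢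
          exact h.unique isGLB_singleton
        rwa [this]
      · have : m (x '' Set.Icc α β) = m (x '' Set.Ico α β) ⊓ x β := by
          refine (hIcc α β hα).unique ?_
          rw [← Set.Ico_insert_right hα, Set.image_insert_eq, inf_comm]
          exact (hm _ ((Set.nonempty_Ico.2 hlt).image x)).insert _
        rw [this]
        exact hβ' α hlt
  have hIci : ∀ α, IsGLB (x '' Set.Ici α) (m (x '' Set.Ici α)) :=
    fun α => hm _ (Set.nonempty_Ici.image x)
  have hcl : ∀ α, m (x '' Set.Ici α) ∈ closure (A α) := by
    intro α
    have hchain : IsChain (· ≤ ·) ((fun γ => m (x '' Set.Icc α γ)) '' Set.Ici α) := by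
      rintro _ ⟨γ, hγ, rfl⟩ _ ⟨δ, hδ, rfl⟩ -
      rcases le_total γ δ with h | h
      · exact Or.inr (hanti α hγ hδ h)
      · exact Or.inl (hanti α hδ hγ h)
    obtain ⟨⟨a, ha, ha'⟩, -⟩ := hX _ (Set.nonempty_Ici.image _) hchain
    rw [(hparts α _ subset_rfl (fun _ _ => Set.Icc_subset_Ici_self)
      Set.nonempty_Ici).unique ha']
    refine closure_mono ?_ ha
    rintro _ ⟨γ, hγ, rfl⟩
    exact hmem γ α hγ
  have hmono : Monotone fun α => m (x '' Set.Ici α) := fun α β hαβ =>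
    (hIci β).mono (hIci α) (Set.image_mono (Set.Ici_subset_Ici.2 hαβ))
  have hchain : IsChain (· ≤ ·) (Set.range fun α => m (x '' Set.Ici α)) := hmono.isChain_range
  obtain ⟨-, b, -, hb⟩ := hX _ (Set.range_nonempty _) hchain
  refine ⟨b, fun α => ?_⟩
  obtain ⟨-, b', hb'cl, hb'⟩ := hX ((fun α => m (x '' Set.Ici α)) '' Set.Ici α)
    (Set.nonempty_Ici.image _) (hchain.mono (Set.image_subset_range _ _))
  have hbb' : b = b' := by
    refine le_antisymm (hb.2 ?_) (hb'.mono hb (Set.image_subset_range _ _))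
    rintro _ ⟨γ, rfl⟩
    exact (hmono (le_max_left γ α)).trans (hb'.1 ⟨max γ α, le_max_right γ α, rfl⟩)
  rw [hbb']
  refine closure_minimal ?_ isClosed_closure hb'cl
  rintro _ ⟨γ, hγ, rfl⟩
  exact closure_mono (hA hγ) (hcl γ)

section Image

variable {X Y : Type*} [SemilatticeInf X] [TopologicalSpace X]
  [SemilatticeInf Y] [TopologicalSpace Y]

theorem IsCompleteTopSemilattice.mem_of_isGLB_image_Ico (hX : IsCompleteTopSemilattice X)
    {ι : Type*} [LinearOrder ι] {A : Set X} (hA : IsClosed A) {α β : ι} {v : ι → X} {c : X}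
    (hαβ : α < β) (hv : AntitoneOn v (Set.Ico α β)) (hvA : ∀ γ ∈ Set.Ico α β, v γ ∈ A)
    (hc : IsGLB (v '' Set.Ico α β) c) : c ∈ A := by
  have hchain : IsChain (· ≤ ·) (v '' Set.Ico α β) := by
    rintro _ ⟨γ, hγ, rfl⟩ _ ⟨δ, hδ, rfl⟩ -
    rcases le_total γ δ with h | h
    · exact Or.inr (hv hγ hδ h)
    · exact Or.inl (hv hδ hγ h)
  obtain ⟨⟨a, ha, ha'⟩, -⟩ := hX _ ((Set.nonempty_Ico.2 hαβ).image v) hchain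
  rw [hc.unique ha']
  exact closure_minimal (Set.image_subset_iff.2 hvA) hA ha

/-- A point of the closure of the image cannot be distinguished from the image by countably many
continuous functions. -/
theorem exists_apply_eq_of_countable (hX : IsCompleteTopSemilattice X)
    (hYsemi : ∀ a : Y, Continuous fun y => a ⊓ y) {h : X → Y} (hc : Continuous h)
    (hhom : ∀ a b : X, h (a ⊓ b) = h a ⊓ h b) {y : Y} (hy : y ∈ closure (Set.range h))
    {f : ℕ → Y → ℝ} (hf : ∀ n, Continuous (f n)) : ∃ x, ∀ n, f n (h x) = f n y := by
  have : Nonempty X := by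
    obtain ⟨_, x, -⟩ := closure_nonempty_iff.1 ⟨y, hy⟩
    exact ⟨x⟩
  let U : ℕ → Set Y := fun n => {z | ∀ k ≤ n, |f k z - f k y| < 1 / ((n : ℝ) + 1)}
  have hUopen : ∀ n, IsOpen (U n) := fun n => by
    have : U n = ⋂ k ∈ Set.Iic n, {z | |f k z - f k y| < 1 / ((n : ℝ) + 1)} := by
      ext z; simp [U]
    rw [this]
    exact (Set.finite_Iic n).isOpen_biInter fun k _ =>
      isOpen_lt (((hf k).sub continuous_const).abs) continuous_const
  have hUy : ∀ n, y ∈ U n := fun n k _ => by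
    rw [sub_self, abs_zero]
    exact Nat.one_div_pos_of_nat
  have hUanti : Antitone U := fun n k hnk z hz i hi =>
    (hz i (hi.trans hnk)).trans_le (Nat.one_div_le_one_div hnk)
  have hYsemi' : ∀ a : Y, Continuous fun z => z ⊓ a := fun a => by
    simpa only [inf_comm] using hYsemi a
  obtain ⟨x, hx⟩ := hX.exists_mem_closure_s1 (A := fun n => {x | h x ∈ U n ∧ h x ⊓ y ∈ U n})
    (fun n k hnk x hx => ⟨hUanti hnk hx.1, hUanti hnk hx.2⟩)
    (by
      intro α β v c hαβ hv hvA hcv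
      have hlast : β - 1 ∈ Set.Ico α β := by simp only [Set.mem_Ico]; omega
      have : IsLeast (v '' Set.Ico α β) (v (β - 1)) := by
        refine ⟨⟨_, hlast, rfl⟩, ?_⟩
        rintro _ ⟨γ, hγ, rfl⟩
        exact hv hγ hlast (Nat.le_sub_one_of_lt hγ.2)
      rw [hcv.unique this.isGLB]
      exact hvA _ hlast)
    (by
      intro n w hw
      let V : Set Y := (U n ∩ (· ⊓ y) ⁻¹' U n) ∩ ⋂ k ∈ Set.Iio n,
        ((h (w k) ⊓ ·) ⁻¹' U k ∩ (fun z => h (w k) ⊓ z ⊓ y) ⁻¹' U k)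
      have hV : IsOpen V := by
        refine ((hUopen n).inter ((hUopen n).preimage (hYsemi' y))).inter
          ((Set.finite_Iio n).isOpen_biInter fun k _ => ?_)
        exact ((hUopen k).preimage (hYsemi _)).inter
          ((hUopen k).preimage ((hYsemi' y).comp (hYsemi (h (w k)))))
      have hyV : y ∈ V := by
        refine ⟨⟨hUy n, ?_⟩, Set.mem_iInter₂.2 fun k hk => ⟨(hw k hk).2, ?_⟩⟩
        · simpa using hUy n
        · simpa [inf_assoc] using (hw k hk).2
      obtain ⟨_, hzV, x, rfl⟩ := mem_closure_iff.1 hy V hV hyV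
      refine ⟨x, hzV.1, fun k hk => ?_⟩
      have : h (w k) ⊓ h x ∈ U k ∧ h (w k) ⊓ h x ⊓ y ∈ U k := Set.mem_iInter₂.1 hzV.2 k hk
      simpa only [Set.mem_ofPred_eq, hhom] using this)
  refine ⟨x, fun n => ?_⟩
  have hle : ∀ k, n ≤ k → |f n (h x) - f n y| ≤ 1 / ((k : ℝ) + 1) := fun k hk => by
    have hcl : IsClosed {x | |f n (h x) - f n y| ≤ 1 / ((k : ℝ) + 1)} :=
      isClosed_le ((((hf n).comp hc).sub continuous_const).abs) continuous_const
    exact closure_minimal (fun z hz => (hz.1 n hk).le) hcl (hx k)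
  have h0 : |f n (h x) - f n y| ≤ 0 :=
    ge_of_tendsto tendsto_one_div_add_atTop_nhds_zero_nat
      (Filter.eventually_atTop.2 ⟨n, hle⟩)
  exact sub_eq_zero.1 (abs_nonpos_iff.1 h0)

open Cardinal in
/-- A point of the closure of the image cannot be distinguished from the image by any family of
continuous functions. -/
theorem exists_apply_eq_of_mem_closure_range (hX : IsCompleteTopSemilattice X)
    (hYsemi : ∀ a : Y, Continuous fun y => a ⊓ y) {h : X → Y} (hc : Continuous h)
    (hhom : ∀ a b : X, h (a ⊓ b) = h a ⊓ h b) {y : Y} (hy : y ∈ closure (Set.range h))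
    {κ : Type*} (f : κ → Y → ℝ) (hf : ∀ k, Continuous (f k)) :
    ∃ x, ∀ k, f k (h x) = f k y := by
  have : Nonempty X := by
    obtain ⟨_, x, -⟩ := closure_nonempty_iff.1 ⟨y, hy⟩
    exact ⟨x⟩
  have hYsemi' : ∀ a : Y, Continuous fun z => z ⊓ a := fun a => by
    simpa only [inf_comm] using hYsemi a
  induction hκ : #κ using WellFoundedLT.induction generalizing κ with
  | ind c ih =>
    rcases le_or_gt c ℵ₀ with hcount | huncount
    · rcases isEmpty_or_nonempty κ with hempty | hne
      · exact ⟨Classical.arbitrary X, fun k => hempty.elim k⟩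
      · have : Countable κ := mk_le_aleph0_iff.1 (hκ ▸ hcount)
        obtain ⟨e, he⟩ := exists_surjective_nat κ
        obtain ⟨x, hx⟩ := exists_apply_eq_of_countable hX hYsemi hc hhom hy fun n => hf (e n)
        exact ⟨x, he.forall.2 hx⟩
    · have hinfinite : ℵ₀ ≤ c := huncount.le
      obtain ⟨e⟩ : Nonempty (c.ord.ToType ≃ κ) := Cardinal.eq.1 (by rw [mk_ord_toType, hκ])
      have : Nonempty c.ord.ToType := by
        rw [← mk_ne_zero_iff, mk_ord_toType]
        exact (aleph0_pos.trans huncount).ne'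
      have hIio : ∀ β : c.ord.ToType, #(Set.Iio β) < c := fun β => by
        simpa using mk_Iio_lt β (by simp)
      have hIic : ∀ β : c.ord.ToType, #(Set.Iic β) < c := fun β => by
        rw [← Set.Iio_insert]
        exact (mk_insert_le).trans_lt
          (add_lt_of_lt hinfinite (hIio β) (one_lt_aleph0.trans_le hinfinite))
      let A : c.ord.ToType → Set X := fun α =>
        {x | ∀ γ ≤ α, f (e γ) (h x) = f (e γ) y ∧ f (e γ) (h x ⊓ y) = f (e γ) y}
      have hAclosed : ∀ α, IsClosed (A α) := fun α => by
        simp only [A, Set.ofPred_forall, Set.ofPred_and]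
        exact isClosed_iInter fun γ => isClosed_iInter fun _ =>
          (isClosed_eq ((hf _).comp hc) continuous_const).inter
            (isClosed_eq ((hf _).comp ((hYsemi' y).comp hc)) continuous_const)
      obtain ⟨x, hx⟩ := hX.exists_mem_closure_s1 (A := A)
        (fun α β hαβ x hx γ hγ => hx γ (hγ.trans hαβ))
        (fun α β v c hαβ hv hvA hcv =>
          hX.mem_of_isGLB_image_Ico (hAclosed α) hαβ hv hvA hcv)
        (by
          intro β w hw
          let p : Option (Set.Iio β) → Y → Y := fun o z => o.elim z fun α => h (w α) ⊓ z
          have hp : ∀ o, Continuous (p o) := by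
            rintro (_ | α)
            · exact continuous_id
            · exact hYsemi _
          let q : Bool → Y → Y := fun b z => bif b then z ⊓ y else z
          have hq : ∀ b, Continuous (q b) := by
            rintro (_ | _)
            · exact continuous_id
            · exact hYsemi' y
          have hcard : #((Option (Set.Iio β) × Set.Iic β) × Bool) < c := by
            simp only [mk_prod, lift_id, lift_uzero, mk_option, mk_bool]
            refine mul_lt_of_lt hinfinite (mul_lt_of_lt hinfinite
              (add_lt_of_lt hinfinite (hIio β) (one_lt_aleph0.trans_le hinfinite)) (hIic β)) ?_
            rw [lift_ofNat]
            exact (natCast_lt_aleph0 (n := 2)).trans_le hinfinite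
          obtain ⟨x, hx⟩ := ih _ hcard
            (fun (i : (Option (Set.Iio β) × Set.Iic β) × Bool) z => f (e i.1.2) (q i.2 (p i.1.1 z)))
            (fun i => (hf (e i.1.2)).comp ((hq i.2).comp (hp i.1.1))) rfl
          refine ⟨x, fun γ hγ => ⟨?_, ?_⟩, fun α hα γ hγ => ⟨?_, ?_⟩⟩
          · exact hx ((none, ⟨γ, hγ⟩), false)
          · have := hx ((none, ⟨γ, hγ⟩), true)
            simpa [p, q] using this
          · have := hx ((some ⟨α, hα⟩, ⟨γ, hγ.trans hα.le⟩), false)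
            simpa [p, q, hhom, (hw α hα γ hγ).2] using this
          · have := hx ((some ⟨α, hα⟩, ⟨γ, hγ.trans hα.le⟩), true)
            simpa [p, q, hhom, inf_assoc, (hw α hα γ hγ).2] using this)
      refine ⟨x, e.surjective.forall.2 fun α => ?_⟩
      exact ((hAclosed α).closure_subset (hx α) α le_rfl).1

end Image

/-- the continuous homomorphic image of a complete topologized semilattice in a
functionally Hausdorff semitopological semilattice is closed. -/
theorem stmt1 {X Y : Type*} [SemilatticeInf X] [TopologicalSpace X]
    [SemilatticeInf Y] [TopologicalSpace Y]
    (hX : IsCompleteTopSemilattice X)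
    (hYsemi : ∀ a : Y, Continuous fun y => a ⊓ y)
    (hY : FunctionallyHausdorff Y)
    (h : X → Y) (hc : Continuous h) (hhom : ∀ a b : X, h (a ⊓ b) = h a ⊓ h b) :
    IsClosed (Set.range h) := by
  refine isClosed_of_closure_subset fun y hy => ?_
  obtain ⟨x, hx⟩ := exists_apply_eq_of_mem_closure_range hX hYsemi hc hhom hy
    (fun f : C(Y, ℝ) => f) fun f => f.continuous
  refine ⟨x, ?_⟩
  by_contra hne
  obtain ⟨f, hf, hfne⟩ := hY _ _ hne
  exact hfne (hx ⟨f, hf⟩)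
end

section
/- Let X be a complete semitopological semilattice satisfying the separation axiom T⃗_{2δ}. Then the partial order P = {(x, y) ∈ X × X : x ⊓ y = x} of X is a closed subset of X × X. -/
open Set Topology

/-- A sequence whose every term satisfies a satisfiable constraint depending only on the
earlier terms. -/
theorem exists_seq_forall_mem_of_local {α : Type*} [Nonempty α] (N : ℕ → (ℕ → α) → Set α)
    (hN : ∀ m w, (N m w).Nonempty)
    (hloc : ∀ m w w', (∀ i < m, w i = w' i) → N m w ⊆ N m w') :
    ∃ w : ℕ → α, ∀ m, w m ∈ N m w := by
  classical
  choose c hc using hN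
  let step : ∀ m : ℕ, (∀ i, i < m → α) → α := fun m ih =>
    c m fun i => if h : i < m then ih i h else Classical.arbitrary α
  refine ⟨wellFounded_lt.fix step, fun m => ?_⟩
  rw [WellFounded.fix_eq]
  refine hloc m _ _ (fun i hi => ?_) (hc m _)
  simp [hi]

/-- The meet of `a` with all `u i` for `n ≤ i < m`. -/
def meetIco {X : Type*} [SemilatticeInf X] (a : X) (u : ℕ → X) (n : ℕ) : ℕ → X
  | 0 => a
  | m + 1 => if n ≤ m then meetIco a u n m ⊓ u m else meetIco a u n m

section MeetIco

variable {X : Type*} [SemilatticeInf X] {a b : X} {u v : ℕ → X} {k n m : ℕ}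

theorem meetIco_succ (h : n ≤ m) : meetIco a u n (m + 1) = meetIco a u n m ⊓ u m :=
  if_pos h

theorem meetIco_of_le (h : m ≤ n) : meetIco a u n m = a := by
  induction m with
  | zero => rfl
  | succ m ih => rw [meetIco, if_neg (by omega), ih (by omega)]

theorem meetIco_le : meetIco a u n m ≤ a := by
  induction m with
  | zero => exact le_rfl
  | succ m ih =>
    rw [meetIco]
    split_ifs
    · exact inf_le_left.trans ih
    · exact ih

theorem antitone_meetIco : Antitone (meetIco a u n) := by
  refine antitone_nat_of_succ_le fun m => ?_
  rw [meetIco]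
  split_ifs
  · exact inf_le_left
  · exact le_rfl

theorem meetIco_congr (h : ∀ i < m, u i = v i) : meetIco a u n m = meetIco a v n m := by
  induction m with
  | zero => rfl
  | succ m ih => rw [meetIco, meetIco, ih fun i hi => h i (by omega), h m (by omega)]

theorem meetIco_le_meetIco_of_le (h : k ≤ n) : meetIco a u k m ≤ meetIco a u n m := by
  induction m with
  | zero => exact le_rfl
  | succ m ih =>
    rw [meetIco, meetIco]
    split_ifs
    · exact inf_le_inf_right _ ih
    · exact inf_le_left.trans ih
    · omega
    · exact ih

theorem meetIco_le_meetIco_meetIco (h : ∀ i, u i ≤ v i) (hkn : k ≤ n) (hnm : n ≤ m) :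
    meetIco a u k m ≤ meetIco (meetIco a u k n) v n m := by
  induction m, hnm using Nat.le_induction with
  | base => rw [meetIco_of_le le_rfl]
  | succ m hnm ih =>
    rw [meetIco_succ (hkn.trans hnm), meetIco_succ hnm]
    exact inf_le_inf ih (h m)

theorem meetIco_meetIco_succ_le (h : ∀ i, u i ≤ v i) (hkn : k ≤ n) (hnm : n + 1 ≤ m) :
    meetIco (meetIco a u k (n + 1)) v (n + 1) m ≤ meetIco (meetIco a u k n) v n m := by
  induction m, hnm using Nat.le_induction with
  | base =>
    rw [meetIco_of_le le_rfl, meetIco_succ hkn, meetIco_succ le_rfl, meetIco_of_le le_rfl]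
    exact inf_le_inf_left _ (h n)
  | succ m hnm ih =>
    rw [meetIco_succ hnm, meetIco_succ (n := n) (m := m) (by omega)]
    exact inf_le_inf_right _ ih

end MeetIco

section Complete

variable {X : Type*} [SemilatticeInf X] [TopologicalSpace X]

theorem IsCompleteTopSemilattice.exists_isGLB_range_s2 (hX : IsCompleteTopSemilattice X)
    {f : ℕ → X} (hf : Antitone f) : ∃ a ∈ closure (range f), IsGLB (range f) a :=
  (hX _ (range_nonempty f) hf.isChain_range).1

theorem IsCompleteTopSemilattice.exists_isLUB_range (hX : IsCompleteTopSemilattice X)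
    {f : ℕ → X} (hf : Monotone f) : ∃ a ∈ closure (range f), IsLUB (range f) a :=
  (hX _ (range_nonempty f) hf.isChain_range).2

/-- The infimum of an antitone sequence lies in the closure of any set that contains the
sequence eventually. -/
theorem IsCompleteTopSemilattice.mem_closure_of_isGLB_range (hX : IsCompleteTopSemilattice X)
    {f : ℕ → X} (hf : Antitone f) {a : X} (ha : IsGLB (range f) a) {s : Set X} {j : ℕ}
    (hs : ∀ n ≥ j, f n ∈ s) : a ∈ closure s := by
  obtain ⟨b, hb, hglb⟩ := hX.exists_isGLB_range_s2 (f := fun n => f (n + j))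
    fun _ _ h => hf (Nat.add_le_add_right h j)
  have hab : a = b := by
    refine ha.unique ⟨?_, fun c hc => hglb.2 ?_⟩
    · rintro _ ⟨n, rfl⟩
      exact (hglb.1 ⟨n, rfl⟩).trans (hf (Nat.le_add_right n j))
    · rintro _ ⟨n, rfl⟩
      exact hc ⟨n + j, rfl⟩
  rw [hab]
  refine closure_mono ?_ hb
  rintro _ ⟨n, rfl⟩
  exact hs _ (Nat.le_add_left j n)

/-- The supremum of a monotone sequence lies in the closure of any set that contains the
sequence eventually. -/
theorem IsCompleteTopSemilattice.mem_closure_of_isLUB_range (hX : IsCompleteTopSemilattice X)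
    {f : ℕ → X} (hf : Monotone f) {a : X} (ha : IsLUB (range f) a) {s : Set X} {j : ℕ}
    (hs : ∀ n ≥ j, f n ∈ s) : a ∈ closure s := by
  obtain ⟨b, hb, hlub⟩ := hX.exists_isLUB_range (f := fun n => f (n + j))
    fun _ _ h => hf (Nat.add_le_add_right h j)
  have hab : a = b := by
    refine ha.unique ⟨?_, fun c hc => hlub.2 ?_⟩
    · rintro _ ⟨n, rfl⟩
      exact (hf (Nat.le_add_right n j)).trans (hlub.1 ⟨n, rfl⟩)
    · rintro _ ⟨n, rfl⟩
      exact hc ⟨n + j, rfl⟩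
  rw [hab]
  refine closure_mono ?_ hb
  rintro _ ⟨n, rfl⟩
  exact hs _ (Nat.le_add_left j n)

/-- Near a point `(x, y)` of the closure of the order there are sequences `u ≤ v` all of whose
mixed meets stay near `x` and `x ⊓ y`. -/
theorem exists_seq_meetIco_mem (hsemi : ∀ a : X, Continuous fun x => a ⊓ x) {x y : X}
    (hxy : (x, y) ∈ closure {p : X × X | p.1 ⊓ p.2 = p.1}) {V : Set X} (hV : IsOpen V)
    (hxV : x ∈ V) {G : ℕ → Set X} (hG : ∀ k, IsOpen (G k)) (hzG : ∀ k, x ⊓ y ∈ G k) :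
    ∃ u v : ℕ → X, (∀ i, u i ≤ v i) ∧ (∀ k m, k ≤ m → meetIco x u k m ∈ V) ∧
      ∀ k n m, k ≤ n → n < m → meetIco (meetIco x u k n) v n m ∈ G k := by
  let p : (ℕ → X × X) → ℕ → ℕ → X := fun w k m => meetIco x (fun i => (w i).1) k m
  let q : (ℕ → X × X) → ℕ → ℕ → ℕ → X := fun w k n m =>
    meetIco (p w k n) (fun i => (w i).2) n m
  let N : ℕ → (ℕ → X × X) → Set (X × X) := fun m w => {c | c.1 ⊓ c.2 = c.1 ∧
    ∀ k ∈ Iic m, ((p w k m ∈ V → p w k m ⊓ c.1 ∈ V) ∧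
      (p w k m ⊓ y ∈ G k → p w k m ⊓ c.1 ⊓ y ∈ G k)) ∧
      ∀ n ∈ Iic m, q w k n m ⊓ y ∈ G k → q w k n m ⊓ c.2 ∈ G k ∧ q w k n m ⊓ c.2 ⊓ y ∈ G k}
  have hinf : ∀ (a b : X) (s : Set X), IsOpen s → a ⊓ b ∈ s → ∀ᶠ t in 𝓝 b, a ⊓ t ∈ s :=
    fun a b s hs h => (hsemi a).continuousAt.eventually_mem (hs.mem_nhds h)
  have hN : ∀ m w, (N m w).Nonempty := by
    intro m w
    have hev : ∀ᶠ c : X × X in 𝓝 (x, y), ∀ k ∈ Iic m,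
        ((p w k m ∈ V → p w k m ⊓ c.1 ∈ V) ∧
        (p w k m ⊓ y ∈ G k → p w k m ⊓ c.1 ⊓ y ∈ G k)) ∧
        ∀ n ∈ Iic m, q w k n m ⊓ y ∈ G k →
          q w k n m ⊓ c.2 ∈ G k ∧ q w k n m ⊓ c.2 ⊓ y ∈ G k := by
      have hfst : Filter.Tendsto Prod.fst (𝓝 (x, y)) (𝓝 x) := continuous_fst.continuousAt
      have hsnd : Filter.Tendsto Prod.snd (𝓝 (x, y)) (𝓝 y) := continuous_snd.continuousAt
      have hpx : ∀ k, p w k m ⊓ x = p w k m := fun k => inf_eq_left.2 meetIco_le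
      rw [Filter.eventually_all_finite (finite_Iic m)]
      refine fun k _ => (Filter.Eventually.and ?_ ?_).and ?_
      · rw [Filter.eventually_imp_distrib_left]
        exact fun h => hfst.eventually (hinf _ _ _ hV ((hpx k).symm ▸ h))
      · rw [Filter.eventually_imp_distrib_left]
        intro h
        have := hfst.eventually (hinf (p w k m ⊓ y) x _ (hG k)
          (by rwa [inf_right_comm, hpx k]))
        simpa only [inf_right_comm _ y] using this
      · rw [Filter.eventually_all_finite (finite_Iic m)]
        intro n _
        rw [Filter.eventually_imp_distrib_left]
        refine fun h => (hsnd.eventually (hinf _ _ _ (hG k) h)).and ?_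
        have := hsnd.eventually (hinf (q w k n m ⊓ y) y _ (hG k)
          (by rwa [inf_assoc, inf_idem]))
        simpa only [inf_right_comm _ y] using this
    obtain ⟨c, hc, hcP⟩ := mem_closure_iff_nhds.1 hxy _ hev
    exact ⟨c, hcP, hc⟩
  have hloc : ∀ m w w', (∀ i < m, w i = w' i) → N m w ⊆ N m w' := by
    rintro m w w' h c ⟨hc, hcN⟩
    have hp : ∀ k, ∀ n ≤ m, p w k n = p w' k n := fun k n hn =>
      meetIco_congr fun i hi => by rw [h i (by omega)]
    have hq : ∀ k, ∀ n ≤ m, q w k n m = q w' k n m := fun k n hn => by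
      simp only [q, hp k n hn]
      exact meetIco_congr fun i hi => by rw [h i hi]
    refine ⟨hc, fun k hk => ?_⟩
    rw [← hp k m le_rfl]
    refine ⟨(hcN k hk).1, fun n hn => ?_⟩
    rw [← hq k n hn]
    exact (hcN k hk).2 n hn
  have : Nonempty (X × X) := ⟨(x, y)⟩
  obtain ⟨w, hw⟩ := exists_seq_forall_mem_of_local N hN hloc
  have hp_self : ∀ k, p w k k = x := fun k => meetIco_of_le le_rfl
  have hp_succ : ∀ {k m}, k ≤ m → p w k (m + 1) = p w k m ⊓ (w m).1 := fun h => meetIco_succ h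
  have hq_self : ∀ k n, q w k n n = p w k n := fun k n => meetIco_of_le le_rfl
  have hq_succ : ∀ {k n m}, n ≤ m → q w k n (m + 1) = q w k n m ⊓ (w m).2 :=
    fun h => meetIco_succ h
  have hpG : ∀ k m, k ≤ m → p w k m ⊓ y ∈ G k := by
    intro k m hkm
    induction m, hkm using Nat.le_induction with
    | base => rw [hp_self]; exact hzG k
    | succ m hkm ih => rw [hp_succ hkm]; exact ((hw m).2 k hkm).1.2 ih
  have hqyG : ∀ k n m, k ≤ n → n ≤ m → q w k n m ⊓ y ∈ G k := by
    intro k n m hkn hnm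
    induction m, hnm using Nat.le_induction with
    | base => rw [hq_self]; exact hpG k n hkn
    | succ m hnm ih =>
      rw [hq_succ hnm]
      exact (((hw m).2 k (hkn.trans hnm)).2 n hnm ih).2
  refine ⟨fun i => (w i).1, fun i => (w i).2, fun i => inf_eq_left.1 (hw i).1, ?_, ?_⟩
  · intro k m hkm
    change p w k m ∈ V
    induction m, hkm using Nat.le_induction with
    | base => rw [hp_self]; exact hxV
    | succ m hkm ih => rw [hp_succ hkm]; exact ((hw m).2 k hkm).1.1 ih
  · intro k n m hkn hnm
    change q w k n m ∈ G k
    obtain ⟨m, rfl⟩ : ∃ j, m = j + 1 := ⟨m - 1, by omega⟩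
    have hnm' : n ≤ m := by omega
    rw [hq_succ hnm']
    exact (((hw m).2 k (hkn.trans hnm')).2 n hnm' (hqyG k n m hkn hnm')).1

/-- If `(x, y)` is in the closure of the order, then `x` and `x ⊓ y` cannot be separated by the
closures of an open neighborhood of `x` and countably many open neighborhoods of `x ⊓ y`. -/
theorem IsCompleteTopSemilattice.nonempty_closure_inter_iInter_closure
    (hX : IsCompleteTopSemilattice X) (hsemi : ∀ a : X, Continuous fun x => a ⊓ x) {x y : X}
    (hxy : (x, y) ∈ closure {p : X × X | p.1 ⊓ p.2 = p.1}) {V : Set X} (hV : IsOpen V)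
    (hxV : x ∈ V) {G : ℕ → Set X} (hG : ∀ k, IsOpen (G k)) (hzG : ∀ k, x ⊓ y ∈ G k)
    (hanti : Antitone G) : (closure V ∩ ⋂ k, closure (G k)).Nonempty := by
  obtain ⟨u, v, huv, hpV, hqG⟩ := exists_seq_meetIco_mem hsemi hxy hV hxV hG hzG
  choose P _ hP using fun k => hX.exists_isGLB_range_s2 (antitone_meetIco (a := x) (u := u) (n := k))
  choose t _ ht using fun k n => hX.exists_isGLB_range_s2
    (antitone_meetIco (a := meetIco x u k n) (u := v) (n := n))
  have hPV : ∀ k, P k ∈ closure V := fun k =>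
    hX.mem_closure_of_isGLB_range antitone_meetIco (hP k) fun m hm => hpV k m hm
  have htG : ∀ k n, k ≤ n → t k n ∈ closure (G k) := fun k n hkn =>
    hX.mem_closure_of_isGLB_range antitone_meetIco (ht k n) (j := n + 1)
      fun m hm => hqG k n m hkn hm
  have ht_succ : ∀ k n, k ≤ n → t k (n + 1) ≤ t k n := by
    intro k n hkn
    refine (ht k n).2 ?_
    rintro _ ⟨m, rfl⟩
    calc t k (n + 1) ≤ meetIco (meetIco x u k (n + 1)) v (n + 1) (max m (n + 1)) :=
          (ht k (n + 1)).1 ⟨_, rfl⟩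
      _ ≤ meetIco (meetIco x u k n) v n (max m (n + 1)) :=
          meetIco_meetIco_succ_le huv hkn (le_max_right _ _)
      _ ≤ meetIco (meetIco x u k n) v n m := antitone_meetIco (le_max_left _ _)
  have hPG : ∀ k, P k ∈ closure (G k) := by
    intro k
    have hmono : Antitone fun n => t k (k + n) :=
      antitone_nat_of_succ_le fun n => ht_succ k (k + n) (Nat.le_add_right k n)
    have hPt : IsGLB (range fun n => t k (k + n)) (P k) := by
      constructor
      · rintro _ ⟨n, rfl⟩
        refine (ht k (k + n)).2 ?_
        rintro _ ⟨m, rfl⟩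
        calc P k ≤ meetIco x u k (max m (k + n)) := (hP k).1 ⟨_, rfl⟩
          _ ≤ meetIco (meetIco x u k (k + n)) v (k + n) (max m (k + n)) :=
              meetIco_le_meetIco_meetIco huv (Nat.le_add_right k n) (le_max_right _ _)
          _ ≤ meetIco (meetIco x u k (k + n)) v (k + n) m := antitone_meetIco (le_max_left _ _)
      · intro c hc
        refine (hP k).2 ?_
        rintro _ ⟨m, rfl⟩
        calc c ≤ t k (k + m) := hc ⟨m, rfl⟩
          _ ≤ meetIco x u k (k + m) := (ht k (k + m)).1 ⟨0, rfl⟩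
          _ ≤ meetIco x u k m := antitone_meetIco (Nat.le_add_left m k)
    have := hX.mem_closure_of_isGLB_range hmono hPt (j := 0) (s := closure (G k))
      fun n _ => htG k (k + n) (Nat.le_add_right k n)
    rwa [closure_closure] at this
  have hPmono : Monotone P := by
    intro k l hkl
    refine (hP l).2 ?_
    rintro _ ⟨m, rfl⟩
    exact ((hP k).1 ⟨m, rfl⟩).trans (meetIco_le_meetIco_of_le hkl)
  obtain ⟨s, -, hs⟩ := hX.exists_isLUB_range hPmono
  refine ⟨s, ?_, mem_iInter.2 fun k => ?_⟩
  · have := hX.mem_closure_of_isLUB_range hPmono hs (j := 0) (s := closure V) fun n _ => hPV n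
    rwa [closure_closure] at this
  · have := hX.mem_closure_of_isLUB_range hPmono hs (j := k) (s := closure (G k))
      fun n hn => closure_mono (hanti hn) (hPG n)
    rwa [closure_closure] at this

end Complete

/-- In a `T_{2δ}`-space, distinct points are separated by a closed neighborhood of the one and
countably many closed neighborhoods of the other. -/
theorem IsT2Delta.exists_closed_nhds {Z : Type*} [TopologicalSpace Z] (hZ : IsT2Delta Z)
    {x z : Z} (hxz : x ≠ z) :
    ∃ (A : Set Z) (F : ℕ → Set Z), IsClosed A ∧ A ∈ 𝓝 x ∧
      (∀ k, IsClosed (F k) ∧ F k ∈ 𝓝 z) ∧ A ∩ ⋂ k, F k = ∅ := by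
  have := hZ.1
  obtain ⟨𝒰, -, h𝒰, hsub⟩ := hZ.2 {z}ᶜ isOpen_compl_singleton x hxz
  obtain ⟨A, hA, hzA⟩ : ∃ A ∈ 𝒰, z ∉ A := by
    by_contra! h
    exact hsub (mem_sInter.2 h) rfl
  obtain ⟨𝒲, hc, h𝒲, hsub'⟩ := hZ.2 Aᶜ (h𝒰 A hA).1.isOpen_compl z hzA
  have hne : 𝒲.Nonempty := by
    rw [nonempty_iff_ne_empty]
    rintro rfl
    exact hsub' (mem_sInter.2 fun _ h => h.elim) (mem_of_mem_nhds (h𝒰 A hA).2)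
  obtain ⟨F, rfl⟩ := hc.exists_eq_range hne
  refine ⟨A, F, (h𝒰 A hA).1, (h𝒰 A hA).2, fun k => h𝒲 _ ⟨k, rfl⟩, ?_⟩
  rw [← sInter_range, eq_empty_iff_forall_notMem]
  exact fun a ha => hsub' ha.2 ha.1

/-- the partial order of a complete semitopological semilattice satisfying
`T⃗_{2δ}` is closed in the square. -/
theorem stmt2 {X : Type u} [SemilatticeInf X] [TopologicalSpace X]
    (hsemi : ∀ a : X, Continuous fun x => a ⊓ x)
    (hX : IsCompleteTopSemilattice X)
    (hT : IsVecT2Delta X) :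
    IsClosed {p : X × X | p.1 ⊓ p.2 = p.1} := by
  obtain ⟨Z, tZ, f, hf, hbij, hZ⟩ := hT
  refine isClosed_of_closure_subset ?_
  rintro ⟨x, y⟩ hxy
  by_contra hne
  have hne' : f x ≠ f (x ⊓ y) := fun h => hne (hbij.1 h).symm
  obtain ⟨A, F, hA, hxA, hF, hempty⟩ := hZ.exists_closed_nhds hne'
  let G : ℕ → Set X := fun k => ⋂ i ∈ Iic k, interior (f ⁻¹' F i)
  have hG : ∀ k, IsOpen (G k) := fun k => (finite_Iic k).isOpen_biInter fun _ _ => isOpen_interior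
  have hzG : ∀ k, x ⊓ y ∈ G k := fun k => mem_iInter₂.2 fun i _ =>
    mem_interior_iff_mem_nhds.2 (hf.continuousAt (hF i).2)
  have hanti : Antitone G := fun _ _ h => biInter_subset_biInter_left (Iic_subset_Iic.2 h)
  obtain ⟨s, hsA, hsG⟩ := hX.nonempty_closure_inter_iInter_closure hsemi hxy
    (isOpen_interior (s := f ⁻¹' A)) (mem_interior_iff_mem_nhds.2 (hf.continuousAt hxA))
    hG hzG hanti
  have hmem : f s ∈ A ∩ ⋂ k, F k := by
    refine ⟨closure_minimal interior_subset (hA.preimage hf) hsA, mem_iInter.2 fun k => ?_⟩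
    refine closure_minimal ?_ ((hF k).1.preimage hf) (mem_iInter.1 hsG k)
    exact (biInter_subset_of_mem self_mem_Iic).trans interior_subset
  rw [hempty] at hmem
  exact hmem
end

section
/- Let Y be a functionally Hausdorff semitopological semilattice and let X ⊆ Y be a subsemilattice (a subset closed under the operation ⊓) that is complete in the subspace topology. Then the partial order P = {(x, y) ∈ X × X : x ⊓ y = x} of X is a closed subset of Y × Y, and X is a closed subset of Y. -/
open Set Topology Cardinal

theorem IsGLBWithin.unique {Y : Type*} [SemilatticeInf Y] {S C : Set Y} {a b : Y}
    (ha : IsGLBWithin S C a) (hb : IsGLBWithin S C b) : a = b :=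
  le_antisymm (hb.2.2 a ha.1 ha.2.1) (ha.2.2 b hb.1 hb.2.1)

theorem IsLUBWithin.unique {Y : Type*} [SemilatticeInf Y] {S C : Set Y} {a b : Y}
    (ha : IsLUBWithin S C a) (hb : IsLUBWithin S C b) : a = b :=
  le_antisymm (ha.2.2 b hb.1 hb.2.1) (hb.2.2 a ha.1 ha.2.1)

theorem FunctionallyHausdorff.t2Space {Y : Type*} [TopologicalSpace Y]
    (hY : FunctionallyHausdorff Y) : T2Space Y := by
  refine ⟨fun x y hxy => ?_⟩
  obtain ⟨f, hf, hne⟩ := hY x y hxy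
  exact separated_by_continuous hf hne

theorem FunctionallyHausdorff.prod {Y Z : Type*} [TopologicalSpace Y] [TopologicalSpace Z]
    (hY : FunctionallyHausdorff Y) (hZ : FunctionallyHausdorff Z) :
    FunctionallyHausdorff (Y × Z) := by
  rintro ⟨a, b⟩ ⟨c, d⟩ hne
  by_cases hac : a = c
  · have hbd : b ≠ d := fun h => hne (by rw [hac, h])
    obtain ⟨f, hf, hfne⟩ := hZ b d hbd
    exact ⟨fun p => f p.2, hf.comp continuous_snd, hfne⟩
  · obtain ⟨f, hf, hfne⟩ := hY a c hac
    exact ⟨fun p => f p.1, hf.comp continuous_fst, hfne⟩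

section Chains

variable {Y : Type*} [SemilatticeInf Y] [TopologicalSpace Y] {X : Set Y}

/-- If every initial block `Icc i γ` of a family, `γ ∈ J`, has an infimum in a complete
subsemilattice, then so does the whole family over `J`, and it is adherent to the block infima. -/
theorem IsCompleteSubSemilattice.exists_isGLBWithin_image {ι : Type*} [LinearOrder ι]
    (hX : IsCompleteSubSemilattice X) {x g : ι → Y} {J : Set ι} {i : ι} (hi : i ∈ J)
    (hJ : ∀ γ ∈ J, i ≤ γ ∧ Icc i γ ⊆ J)
    (hg : ∀ γ ∈ J, IsGLBWithin X (x '' Icc i γ) (g γ)) :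
    ∃ m ∈ closure (g '' J), IsGLBWithin X (x '' J) m := by
  have anti : ∀ γ ∈ J, ∀ δ ∈ J, γ ≤ δ → g δ ≤ g γ := fun γ hγ δ hδ hle =>
    (hg γ hγ).2.2 _ (hg δ hδ).1 fun c hc =>
      (hg δ hδ).2.1 c (image_mono (Icc_subset_Icc_right hle) hc)
  have hchain : IsChain (· ≤ ·) (g '' J) := by
    rintro _ ⟨γ, hγ, rfl⟩ _ ⟨δ, hδ, rfl⟩ -
    rcases le_total γ δ with h | h
    · exact Or.inr (anti γ hγ δ hδ h)
    · exact Or.inl (anti δ hδ γ hγ h)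
  obtain ⟨⟨m, hmcl, hmX, hmle, hmge⟩, -⟩ := hX (g '' J)
    (by rintro _ ⟨γ, hγ, rfl⟩; exact (hg γ hγ).1) ⟨_, mem_image_of_mem g hi⟩ hchain
  refine ⟨m, hmcl, hmX, ?_, fun b hb hble => hmge b hb ?_⟩
  · rintro _ ⟨γ, hγ, rfl⟩
    exact (hmle _ (mem_image_of_mem g hγ)).trans
      ((hg γ hγ).2.1 _ (mem_image_of_mem x ⟨(hJ γ hγ).1, le_rfl⟩))
  · rintro _ ⟨γ, hγ, rfl⟩
    exact (hg γ hγ).2.2 b hb fun c hc => hble c (image_mono (hJ γ hγ).2 hc)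

/-- A complete subsemilattice meets the intersection of the closures of an antitone well-ordered
family of sets, provided that one can recursively pick points whose block infima stay in the
respective sets. -/
theorem IsCompleteSubSemilattice.exists_mem_forall_mem_closure {ι : Type*} [LinearOrder ι]
    [WellFoundedLT ι] [Nonempty ι] [Nonempty Y] (hsub : ∀ a ∈ X, ∀ b ∈ X, a ⊓ b ∈ X)
    (hX : IsCompleteSubSemilattice X) (V : ι → Set Y) (hV : Antitone V)
    (hstep : ∀ (α : ι) (m : ι → Y), (∀ i < α, m i ∈ V i) →
      ∃ y ∈ X, y ∈ V α ∧ ∀ i < α, m i ⊓ y ∈ V i)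
    (hlim : ∀ (α : ι), ∀ i < α, ∀ g : ι → Y, (∀ γ ∈ Ico i α, g γ ∈ V i) →
      closure (g '' Ico i α) ⊆ V i) :
    ∃ a ∈ X, ∀ i, a ∈ closure (V i) := by
  let G : Set Y → Y := fun S => Classical.epsilon (IsGLBWithin X S)
  have hG : ∀ {S m}, IsGLBWithin X S m → IsGLBWithin X S (G S) :=
    fun h => Classical.epsilon_spec ⟨_, h⟩
  let Q : ι → (ι → Y) → Y → Prop := fun α m y => y ∈ X ∧ y ∈ V α ∧ ∀ i < α, m i ⊓ y ∈ V i
  let step : (α : ι) → ((β : ι) → β < α → Y) → Y := fun α g =>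
    Classical.epsilon (Q α fun i => G {z | ∃ β, ∃ h : β < α, i ≤ β ∧ g β h = z})
  let x : ι → Y := wellFounded_lt.fix step
  have hx : ∀ α, x α = Classical.epsilon (Q α fun i => G (x '' Ico i α)) := by
    intro α
    have h1 : x α = step α fun β _ => x β := wellFounded_lt.fix_eq step α
    have h2 : ∀ i, {z | ∃ β, ∃ _ : β < α, i ≤ β ∧ x β = z} = x '' Ico i α := by
      intro i
      ext z
      simp only [mem_ofPred_eq, mem_image, mem_Ico, exists_prop]
      exact exists_congr fun β => by tauto
    rw [h1]
    simp only [step, h2]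
  have key : ∀ α, ∀ i ≤ α, ∃ M, IsGLBWithin X (x '' Icc i α) M ∧ M ∈ V i := by
    intro α
    induction α using WellFoundedLT.induction with
    | _ α ih =>
    have hm : ∀ i < α, IsGLBWithin X (x '' Ico i α) (G (x '' Ico i α)) ∧
        G (x '' Ico i α) ∈ V i := by
      intro i hi
      have ih' : ∀ γ ∈ Ico i α, IsGLBWithin X (x '' Icc i γ) (G (x '' Icc i γ)) ∧
          G (x '' Icc i γ) ∈ V i := by
        intro γ hγ
        obtain ⟨M, hM, hMV⟩ := ih γ hγ.2 i hγ.1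
        exact ⟨hG hM, (hM.unique (hG hM)) ▸ hMV⟩
      obtain ⟨m, hmcl, hm⟩ := hX.exists_isGLBWithin_image (J := Ico i α) (i := i)
        ⟨le_rfl, hi⟩ (fun γ hγ => ⟨hγ.1, fun δ hδ => ⟨hδ.1, hδ.2.trans_lt hγ.2⟩⟩)
        (fun γ hγ => (ih' γ hγ).1)
      refine ⟨hG hm, ?_⟩
      rw [← hm.unique (hG hm)]
      exact hlim α i hi _ (fun γ hγ => (ih' γ hγ).2) hmcl
    have hQ : Q α (fun i => G (x '' Ico i α)) (x α) := by
      rw [hx α]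
      obtain ⟨y, hyX, hyV, hy⟩ := hstep α (fun i => G (x '' Ico i α)) fun i hi => (hm i hi).2
      exact Classical.epsilon_spec (p := Q α fun i => G (x '' Ico i α)) ⟨y, hyX, hyV, hy⟩
    obtain ⟨hxX, hxV, hxm⟩ := hQ
    intro i hi
    rcases hi.eq_or_lt with rfl | hi
    · refine ⟨x i, ?_, hxV⟩
      rw [Icc_self, image_singleton]
      exact ⟨hxX, fun c hc => (mem_singleton_iff.1 hc).ge, fun b _ hb => hb _ rfl⟩
    · obtain ⟨hglb, hmV⟩ := hm i hi
      refine ⟨G (x '' Ico i α) ⊓ x α, ⟨hsub _ hglb.1 _ hxX, ?_, ?_⟩, hxm i hi⟩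
      · rintro _ ⟨γ, hγ, rfl⟩
        rcases hγ.2.eq_or_lt with rfl | hlt
        · exact inf_le_right
        · exact inf_le_left.trans (hglb.2.1 _ ⟨γ, ⟨hγ.1, hlt⟩, rfl⟩)
      · intro b hb hble
        refine le_inf (hglb.2.2 b hb fun c hc => hble c (image_mono Ico_subset_Icc_self hc)) ?_
        exact hble _ ⟨α, ⟨hi.le, le_rfl⟩, rfl⟩
  have htail : ∀ i, ∃ a ∈ closure (V i), IsGLBWithin X (x '' Ici i) a := by
    intro i
    choose! g hg hgV using fun γ (h : i ≤ γ) => key γ i h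
    obtain ⟨m, hmcl, hm⟩ := hX.exists_isGLBWithin_image (J := Ici i) (i := i)
      self_mem_Ici (fun γ hγ => ⟨hγ, fun δ hδ => hδ.1⟩) (fun γ hγ => hg γ hγ)
    exact ⟨m, closure_mono (by rintro _ ⟨γ, hγ, rfl⟩; exact hgV γ hγ) hmcl, hm⟩
  choose a haV ha using htail
  have hmono : Monotone a := fun i j hij => (ha j).2.2 _ (ha i).1 fun c hc =>
    (ha i).2.1 c (image_mono (Ici_subset_Ici.2 hij) hc)
  have hsup : ∀ k, ∃ b ∈ closure (a '' Ici k), IsLUBWithin X (range a) b := by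
    intro k
    obtain ⟨-, b, hbcl, hbX, hble, hbge⟩ := hX (a '' Ici k)
      (by rintro _ ⟨γ, -, rfl⟩; exact (ha γ).1) ⟨_, mem_image_of_mem a self_mem_Ici⟩
      (by
        rintro _ ⟨γ, -, rfl⟩ _ ⟨δ, -, rfl⟩ -
        exact (le_total γ δ).imp (fun h => hmono h) (fun h => hmono h))
    refine ⟨b, hbcl, hbX, ?_, fun c hc hcle => hbge c hc ?_⟩
    · rintro _ ⟨γ, rfl⟩
      exact (hmono (le_max_left γ k)).trans (hble _ ⟨max γ k, le_max_right γ k, rfl⟩)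
    · rintro _ ⟨γ, -, rfl⟩
      exact hcle _ ⟨γ, rfl⟩
  choose b hbcl hb using hsup
  obtain ⟨i₀⟩ := ‹Nonempty ι›
  refine ⟨b i₀, (hb i₀).1, fun i => ?_⟩
  rw [(hb i₀).unique (hb i)]
  refine closure_minimal ?_ isClosed_closure (hbcl i)
  rintro _ ⟨γ, hγ, rfl⟩
  exact closure_mono (hV hγ) (haV γ)

/-- For a point adherent to a complete subsemilattice `X`, countably many continuous functions
cannot distinguish it from a suitable point of `X`. -/
theorem IsCompleteSubSemilattice.exists_forall_nat_eq [T1Space Y]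
    (hsemi : ∀ a : Y, Continuous fun y => a ⊓ y) (hsub : ∀ a ∈ X, ∀ b ∈ X, a ⊓ b ∈ X)
    (hX : IsCompleteSubSemilattice X) {x : Y} (hx : x ∈ closure X)
    (φ : ℕ → Y → ℝ) (hφ : ∀ n, Continuous (φ n)) :
    ∃ a ∈ X, ∀ n, φ n a = φ n x ∧ φ n (x ⊓ a) = φ n x := by
  have : Nonempty Y := ⟨x⟩
  let r : ℕ → ℝ := fun i => 1 / ((i : ℝ) + 1)
  let V : ℕ → Set Y := fun i =>
    {y | ∀ j ≤ i, |φ j y - φ j x| < r i ∧ |φ j (x ⊓ y) - φ j x| < r i}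
  have hVo : ∀ i, IsOpen (V i) := by
    intro i
    have : V i = ⋂ j ∈ Iic i,
        {y | |φ j y - φ j x| < r i} ∩ {y | |φ j (x ⊓ y) - φ j x| < r i} := by
      ext y; simp [V]
    rw [this]
    refine (finite_Iic i).isOpen_biInter fun j _ => IsOpen.inter ?_ ?_
    · exact isOpen_lt (((hφ j).sub continuous_const).abs) continuous_const
    · exact isOpen_lt ((((hφ j).comp (hsemi x)).sub continuous_const).abs) continuous_const
  have hVinf : ∀ i, ∀ m ∈ V i, m ⊓ x ∈ V i := by
    intro i m hm j hj
    have h := (hm j hj).2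
    rw [inf_comm m x, ← inf_assoc, inf_idem]
    exact ⟨h, h⟩
  have hVx : ∀ i, x ∈ V i := by
    intro i j _
    have hr : 0 < r i := by positivity
    simpa using hr
  have hVanti : Antitone V := by
    intro i k hik y hy j hj
    have hr : r k ≤ r i := Nat.one_div_le_one_div hik
    exact ⟨(hy j (hj.trans hik)).1.trans_le hr, (hy j (hj.trans hik)).2.trans_le hr⟩
  obtain ⟨a, haX, ha⟩ := hX.exists_mem_forall_mem_closure hsub V hVanti
    (by
      intro α m hm
      have ho : IsOpen (V α ∩ ⋂ i ∈ Iio α, {y | m i ⊓ y ∈ V i}) :=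
        (hVo α).inter ((finite_Iio α).isOpen_biInter fun i _ => (hVo i).preimage (hsemi (m i)))
      obtain ⟨y, ⟨hyV, hy⟩, hyX⟩ := mem_closure_iff.1 hx _ ho
        ⟨hVx α, mem_iInter₂.2 fun i hi => hVinf i _ (hm i hi)⟩
      exact ⟨y, hyX, hyV, fun i hi => mem_iInter₂.1 hy i hi⟩)
    (by
      intro α i _ g hg
      rw [((finite_Ico i α).image g).isClosed.closure_eq]
      rintro _ ⟨γ, hγ, rfl⟩
      exact hg γ hγ)
  refine ⟨a, haX, fun n => ?_⟩
  have hle : ∀ k ≥ n, |φ n a - φ n x| ≤ r k ∧ |φ n (x ⊓ a) - φ n x| ≤ r k := by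
    intro k hk
    have hc : IsClosed ({y | |φ n y - φ n x| ≤ r k} ∩ {y | |φ n (x ⊓ y) - φ n x| ≤ r k}) :=
      (isClosed_le (((hφ n).sub continuous_const).abs) continuous_const).inter
        (isClosed_le ((((hφ n).comp (hsemi x)).sub continuous_const).abs) continuous_const)
    refine closure_minimal ?_ hc (ha k)
    exact fun y hy => ⟨(hy n hk).1.le, (hy n hk).2.le⟩
  have hr : Filter.Tendsto r Filter.atTop (𝓝 0) := tendsto_one_div_add_atTop_nhds_zero_nat
  have h1 : |φ n a - φ n x| ≤ 0 := ge_of_tendsto hr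
    (Filter.eventually_atTop.2 ⟨n, fun k hk => (hle k hk).1⟩)
  have h2 : |φ n (x ⊓ a) - φ n x| ≤ 0 := ge_of_tendsto hr
    (Filter.eventually_atTop.2 ⟨n, fun k hk => (hle k hk).2⟩)
  exact ⟨sub_eq_zero.1 (abs_nonpos_iff.1 h1), sub_eq_zero.1 (abs_nonpos_iff.1 h2)⟩

/-- For a point adherent to a complete subsemilattice `X`, no family of continuous functions
can distinguish it from a suitable point of `X`. -/
theorem IsCompleteSubSemilattice.exists_forall_eq [T1Space Y]
    (hsemi : ∀ a : Y, Continuous fun y => a ⊓ y) (hsub : ∀ a ∈ X, ∀ b ∈ X, a ⊓ b ∈ X)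
    (hX : IsCompleteSubSemilattice X) {x : Y} (hx : x ∈ closure X) (κ : Cardinal.{v}) :
    ∀ (J : Type v), #J = κ → ∀ φ : J → Y → ℝ, (∀ j, Continuous (φ j)) →
      ∃ a ∈ X, ∀ j, φ j a = φ j x ∧ φ j (x ⊓ a) = φ j x := by
  induction κ using Cardinal.lt_wf.induction with
  | _ κ ih =>
  rintro J rfl φ hφ
  have : Nonempty Y := ⟨x⟩
  rcases isEmpty_or_nonempty J with hJ | hJ
  · obtain ⟨a, ha⟩ := closure_nonempty_iff.1 ⟨x, hx⟩
    exact ⟨a, ha, fun j => isEmptyElim j⟩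
  by_cases hc : Countable J
  · obtain ⟨e, he⟩ := exists_surjective_nat J
    obtain ⟨a, haX, ha⟩ := hX.exists_forall_nat_eq hsemi hsub hx (fun n => φ (e n))
      fun n => hφ (e n)
    refine ⟨a, haX, fun j => ?_⟩
    obtain ⟨n, rfl⟩ := he j
    exact ha n
  have hinf : ℵ₀ ≤ #J := by
    rw [← Cardinal.mk_le_aleph0_iff, not_le] at hc
    exact hc.le
  obtain ⟨_, _, hord⟩ := Cardinal.exists_ord_eq_type_lt J
  let V : J → Set Y := fun i => {y | ∀ j ≤ i, φ j y = φ j x ∧ φ j (x ⊓ y) = φ j x}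
  have hVc : ∀ i, IsClosed (V i) := by
    intro i
    have : V i = ⋂ j ∈ Iic i, {y | φ j y = φ j x} ∩ {y | φ j (x ⊓ y) = φ j x} := by
      ext y; simp [V]
    rw [this]
    exact isClosed_biInter fun j _ => (isClosed_eq (hφ j) continuous_const).inter
      (isClosed_eq ((hφ j).comp (hsemi x)) continuous_const)
  obtain ⟨a, haX, ha⟩ := hX.exists_mem_forall_mem_closure hsub V
    (fun i k hik y hy j hj => hy j (hj.trans hik))
    (by
      intro α m hm
      have hcard : #(Iic α × Iic α) < #J := by
        rw [Cardinal.mk_prod, Cardinal.lift_id]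
        exact Cardinal.mul_lt_of_lt hinf (Cardinal.mk_Iic_lt α hord hinf)
          (Cardinal.mk_Iic_lt α hord hinf)
      obtain ⟨y, hyX, hy⟩ := ih _ hcard (Iic α × Iic α) rfl
        (fun p y => if (p.2 : J) = α then φ p.1 y else φ p.1 (m p.2 ⊓ y))
        (by
          rintro ⟨j, i⟩
          by_cases h : (i : J) = α
          · simpa [h] using hφ j
          · simpa [h] using! (hφ j).comp (hsemi (m i)))
      refine ⟨y, hyX, fun j hj => ?_, fun i hi j hj => ?_⟩
      · simpa using hy (⟨j, hj⟩, ⟨α, le_rfl⟩)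
      · have h := hy (⟨j, hj.trans hi.le⟩, ⟨i, hi.le⟩)
        simp only [hi.ne, if_false] at h
        rw [inf_left_comm x, h.1, h.2, inf_comm (m i) x]
        exact ⟨(hm i hi j hj).2, (hm i hi j hj).2⟩)
    (by
      intro α i _ g hg
      refine closure_minimal ?_ (hVc i)
      rintro _ ⟨γ, hγ, rfl⟩
      exact hg γ hγ)
  refine ⟨a, haX, fun j => ?_⟩
  have h := ha j
  rw [(hVc j).closure_eq] at h
  exact h j le_rfl

theorem IsCompleteSubSemilattice.isClosed
    (hsemi : ∀ a : Y, Continuous fun y => a ⊓ y) (hY : FunctionallyHausdorff Y)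
    (hsub : ∀ a ∈ X, ∀ b ∈ X, a ⊓ b ∈ X) (hX : IsCompleteSubSemilattice X) : IsClosed X := by
  have := hY.t2Space
  refine isClosed_of_closure_subset fun x hx => ?_
  obtain ⟨a, haX, ha⟩ := hX.exists_forall_eq hsemi hsub hx _ {f : Y → ℝ // Continuous f} rfl
    (fun f => f.1) fun f => f.2
  have hax : a = x := by
    by_contra hne
    obtain ⟨f, hf, hfne⟩ := hY a x hne
    exact hfne (ha ⟨f, hf⟩).1
  exact hax ▸ haX

/-- In a complete subsemilattice, a chain read downwards eventually enters each neighbourhood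
of its infimum. -/
theorem IsCompleteSubSemilattice.exists_forall_le_mem_of_isGLBWithin
    (hX : IsCompleteSubSemilattice X) {C : Set Y} (hCX : C ⊆ X) (hne : C.Nonempty)
    (hC : IsChain (· ≤ ·) C) {a : Y} (ha : IsGLBWithin X C a) {U : Set Y} (hU : IsOpen U)
    (haU : a ∈ U) : ∃ c ∈ C, ∀ d ∈ C, d ≤ c → d ∈ U := by
  by_contra! hcon
  obtain ⟨c₀, hc₀⟩ := hne
  obtain ⟨d₀, hd₀, -, hd₀U⟩ := hcon c₀ hc₀
  obtain ⟨⟨b, hbcl, hb⟩, -⟩ := hX (C \ U) (sdiff_subset.trans hCX) ⟨d₀, hd₀, hd₀U⟩ (hC.mono sdiff_subset)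
  have hab : a = b := by
    refine le_antisymm (hb.2.2 a ha.1 fun c hc => ha.2.1 c hc.1) (ha.2.2 b hb.1 fun c hc => ?_)
    obtain ⟨d, hd, hdc, hdU⟩ := hcon c hc
    exact (hb.2.1 d ⟨hd, hdU⟩).trans hdc
  obtain ⟨d, hdU, hd⟩ := mem_closure_iff.1 hbcl U hU (hab ▸ haU)
  exact hd.2 hdU

/-- In a complete subsemilattice, a chain eventually enters each neighbourhood of its supremum. -/
theorem IsCompleteSubSemilattice.exists_forall_ge_mem_of_isLUBWithin
    (hX : IsCompleteSubSemilattice X) {C : Set Y} (hCX : C ⊆ X) (hne : C.Nonempty)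
    (hC : IsChain (· ≤ ·) C) {a : Y} (ha : IsLUBWithin X C a) {U : Set Y} (hU : IsOpen U)
    (haU : a ∈ U) : ∃ c ∈ C, ∀ d ∈ C, c ≤ d → d ∈ U := by
  by_contra! hcon
  obtain ⟨c₀, hc₀⟩ := hne
  obtain ⟨d₀, hd₀, -, hd₀U⟩ := hcon c₀ hc₀
  obtain ⟨-, b, hbcl, hb⟩ := hX (C \ U) (sdiff_subset.trans hCX) ⟨d₀, hd₀, hd₀U⟩ (hC.mono sdiff_subset)
  have hab : a = b := by
    refine le_antisymm (ha.2.2 b hb.1 fun c hc => ?_) (hb.2.2 a ha.1 fun c hc => ha.2.1 c hc.1)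
    obtain ⟨d, hd, hdc, hdU⟩ := hcon c hc
    exact hdc.trans (hb.2.1 d ⟨hd, hdU⟩)
  obtain ⟨d, hdU, hd⟩ := mem_closure_iff.1 hbcl U hU (hab ▸ haU)
  exact hd.2 hdU

/-- The order relation of a complete subsemilattice is a complete subsemilattice of the square. -/
theorem IsCompleteSubSemilattice.order (hX : IsCompleteSubSemilattice X) :
    IsCompleteSubSemilattice {p : Y × Y | p.1 ∈ X ∧ p.2 ∈ X ∧ p.1 ⊓ p.2 = p.1} := by
  intro C hCP hne hC
  have hfX : Prod.fst '' C ⊆ X := by rintro _ ⟨p, hp, rfl⟩; exact (hCP hp).1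
  have hsX : Prod.snd '' C ⊆ X := by rintro _ ⟨p, hp, rfl⟩; exact (hCP hp).2.1
  have hle : ∀ p ∈ C, p.1 ≤ p.2 := fun p hp => inf_eq_left.1 (hCP hp).2.2
  have hfC : IsChain (· ≤ ·) (Prod.fst '' C) := by
    rintro _ ⟨p, hp, rfl⟩ _ ⟨q, hq, rfl⟩ -
    exact (hC.total hp hq).imp (fun h => h.1) fun h => h.1
  have hsC : IsChain (· ≤ ·) (Prod.snd '' C) := by
    rintro _ ⟨p, hp, rfl⟩ _ ⟨q, hq, rfl⟩ -
    exact (hC.total hp hq).imp (fun h => h.2) fun h => h.2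
  obtain ⟨⟨a₁, -, ha₁⟩, b₁, -, hb₁⟩ := hX _ hfX (hne.image _) hfC
  obtain ⟨⟨a₂, -, ha₂⟩, b₂, -, hb₂⟩ := hX _ hsX (hne.image _) hsC
  refine ⟨⟨(a₁, a₂), ?_, ⟨ha₁.1, ha₂.1, inf_eq_left.2 ?_⟩, ?_, ?_⟩,
    (b₁, b₂), ?_, ⟨hb₁.1, hb₂.1, inf_eq_left.2 ?_⟩, ?_, ?_⟩
  · refine mem_closure_iff.2 fun W hW haW => ?_
    obtain ⟨U, V, hU, hV, haU, haV, hUV⟩ := isOpen_prod_iff.1 hW a₁ a₂ haW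
    obtain ⟨_, ⟨p, hp, rfl⟩, hpU⟩ :=
      hX.exists_forall_le_mem_of_isGLBWithin hfX (hne.image _) hfC ha₁ hU haU
    obtain ⟨_, ⟨q, hq, rfl⟩, hqV⟩ :=
      hX.exists_forall_le_mem_of_isGLBWithin hsX (hne.image _) hsC ha₂ hV haV
    rcases hC.total hp hq with h | h
    · exact ⟨p, hUV ⟨hpU _ ⟨p, hp, rfl⟩ le_rfl, hqV _ ⟨p, hp, rfl⟩ h.2⟩, hp⟩
    · exact ⟨q, hUV ⟨hpU _ ⟨q, hq, rfl⟩ h.1, hqV _ ⟨q, hq, rfl⟩ le_rfl⟩, hq⟩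
  · refine ha₂.2.2 _ ha₁.1 ?_
    rintro _ ⟨p, hp, rfl⟩
    exact (ha₁.2.1 _ ⟨p, hp, rfl⟩).trans (hle p hp)
  · exact fun p hp => ⟨ha₁.2.1 _ ⟨p, hp, rfl⟩, ha₂.2.1 _ ⟨p, hp, rfl⟩⟩
  · intro b hb hble
    exact ⟨ha₁.2.2 _ hb.1 (by rintro _ ⟨p, hp, rfl⟩; exact (hble p hp).1),
      ha₂.2.2 _ hb.2.1 (by rintro _ ⟨p, hp, rfl⟩; exact (hble p hp).2)⟩
  · refine mem_closure_iff.2 fun W hW hbW => ?_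
    obtain ⟨U, V, hU, hV, hbU, hbV, hUV⟩ := isOpen_prod_iff.1 hW b₁ b₂ hbW
    obtain ⟨_, ⟨p, hp, rfl⟩, hpU⟩ :=
      hX.exists_forall_ge_mem_of_isLUBWithin hfX (hne.image _) hfC hb₁ hU hbU
    obtain ⟨_, ⟨q, hq, rfl⟩, hqV⟩ :=
      hX.exists_forall_ge_mem_of_isLUBWithin hsX (hne.image _) hsC hb₂ hV hbV
    rcases hC.total hp hq with h | h
    · exact ⟨q, hUV ⟨hpU _ ⟨q, hq, rfl⟩ h.1, hqV _ ⟨q, hq, rfl⟩ le_rfl⟩, hq⟩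
    · exact ⟨p, hUV ⟨hpU _ ⟨p, hp, rfl⟩ le_rfl, hqV _ ⟨p, hp, rfl⟩ h.2⟩, hp⟩
  · refine hb₁.2.2 _ hb₂.1 ?_
    rintro _ ⟨p, hp, rfl⟩
    exact (hle p hp).trans (hb₂.2.1 _ ⟨p, hp, rfl⟩)
  · exact fun p hp => ⟨hb₁.2.1 _ ⟨p, hp, rfl⟩, hb₂.2.1 _ ⟨p, hp, rfl⟩⟩
  · intro b hb hble
    exact ⟨hb₁.2.2 _ hb.1 (by rintro _ ⟨p, hp, rfl⟩; exact (hble p hp).1),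
      hb₂.2.2 _ hb.2.1 (by rintro _ ⟨p, hp, rfl⟩; exact (hble p hp).2)⟩

end Chains

/-- for a complete subsemilattice `X` of a functionally Hausdorff
semitopological semilattice `Y`, the partial order of `X` is closed in `Y × Y` and `X` is
closed in `Y`. -/
theorem stmt3 {Y : Type*} [SemilatticeInf Y] [TopologicalSpace Y]
    (hsemi : ∀ a : Y, Continuous fun y => a ⊓ y)
    (hY : FunctionallyHausdorff Y)
    (X : Set Y) (hsub : ∀ a ∈ X, ∀ b ∈ X, a ⊓ b ∈ X)
    (hX : IsCompleteSubSemilattice X) :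
    IsClosed {p : Y × Y | p.1 ∈ X ∧ p.2 ∈ X ∧ p.1 ⊓ p.2 = p.1} ∧ IsClosed X := by
  refine ⟨hX.order.isClosed (fun a => ?_) (hY.prod hY) ?_, hX.isClosed hsemi hY hsub⟩
  · exact ((hsemi a.1).comp continuous_fst).prodMk ((hsemi a.2).comp continuous_snd)
  · rintro a ⟨ha₁, ha₂, ha⟩ b ⟨hb₁, hb₂, hb⟩
    exact ⟨hsub _ ha₁ _ hb₁, hsub _ ha₂ _ hb₂,
      inf_eq_left.2 (inf_le_inf (inf_eq_left.1 ha) (inf_eq_left.1 hb))⟩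
end

section
/- Every nonempty subsemilattice S of a complete topologized semilattice X (i.e., every nonempty subset S ⊆ X closed under the operation ⊓) has a greatest lower bound inf S in X, and inf S belongs to the closure of S in X. -/
/-- In a complete topologized semilattice, every nonempty set has a greatest lower bound, which
lies in the closure of the subsemilattice generated by the set. -/
theorem IsCompleteTopSemilattice.exists_isGLB_mem_closure_infClosure {X : Type*}
    [SemilatticeInf X] [TopologicalSpace X] (hX : IsCompleteTopSemilattice X) (T : Set X)
    (hT : T.Nonempty) : ∃ a ∈ closure (infClosure T), IsGLB T a := by
  induction hc : Cardinal.mk T using WellFoundedLT.induction generalizing T with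
  | ind c ih =>
  subst hc
  rcases T.finite_or_infinite with hfin | hinf
  · lift T to Finset X using hfin
    exact ⟨T.inf' hT id, subset_closure (finsetInf'_mem_infClosure hT fun i hi ↦ hi),
      fun x hx ↦ Finset.inf'_le id hx, fun b hb ↦ Finset.le_inf' hT id fun x hx ↦ hb hx⟩
  · obtain ⟨e⟩ : Nonempty ((Cardinal.mk T).ord.ToType ≃ T) := by
      rw [← Cardinal.eq, Cardinal.mk_ord_toType]
    let A : (Cardinal.mk T).ord.ToType → Set X := fun i ↦ (fun j ↦ (e j : X)) '' Set.Iic i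
    have hAT (i) : A i ⊆ T := by
      rintro _ ⟨j, -, rfl⟩
      exact (e j).2
    have hA (i) : ∃ a ∈ closure (infClosure (A i)), IsGLB (A i) a := by
      refine ih _ ?_ (A i) ⟨_, i, Set.self_mem_Iic, rfl⟩ rfl
      have hlt := Cardinal.mk_Iic_lt i (by simp) (by
        simpa using Cardinal.infinite_iff.mp hinf.to_subtype)
      rw [Cardinal.mk_ord_toType] at hlt
      exact Cardinal.mk_image_le.trans_lt hlt
    choose a ha_mem ha_glb using hA
    have hanti : Antitone a := fun i j hij ↦
      (ha_glb i).mono (ha_glb j) (Set.image_mono (Set.Iic_subset_Iic.mpr hij))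
    obtain ⟨⟨b, hb_mem, hb⟩, -⟩ := hX (Set.range a)
      ⟨_, e.symm ⟨_, hT.some_mem⟩, rfl⟩ hanti.isChain_range
    refine ⟨b, closure_minimal ?_ isClosed_closure hb_mem, fun x hx ↦ ?_, fun l hl ↦ ?_⟩
    · rintro _ ⟨i, rfl⟩
      exact closure_mono (infClosure_mono (hAT i)) (ha_mem i)
    · exact (hb.1 ⟨e.symm ⟨x, hx⟩, rfl⟩).trans
        ((ha_glb _).1 ⟨e.symm ⟨x, hx⟩, Set.self_mem_Iic, by simp⟩)
    · refine hb.2 ?_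
      rintro _ ⟨i, rfl⟩
      exact (ha_glb i).2 fun x hx ↦ hl (hAT i hx)

/-- every nonempty subsemilattice of a complete topologized semilattice has an
infimum belonging to its closure. -/
theorem stmt4 {X : Type*} [SemilatticeInf X] [TopologicalSpace X]
    (hX : IsCompleteTopSemilattice X)
    (S : Set X) (hne : S.Nonempty) (hsub : ∀ a ∈ S, ∀ b ∈ S, a ⊓ b ∈ S) :
    ∃ a ∈ closure S, IsGLB S a := by
  have hS : InfClosed S := fun a ha b hb ↦ hsub a ha b hb
  simpa [hS.infClosure_eq] using hX.exists_isGLB_mem_closure_infClosure S hne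
end

section
/- Let Y be a semitopological semilattice satisfying the separation axiom T_{2δ} and let X ⊆ Y be a subsemilattice (a subset closed under the operation ⊓) that is complete in the subspace topology. Then the partial order P = {(x, y) ∈ X × X : x ⊓ y = x} of X is a closed subset of Y × Y. -/
/-- The infimum of `z` and all `x i` with `i ∈ F`. -/
def infOver {I L : Type*} [SemilatticeInf L] (x : I → L) (F : Finset I) (z : L) : L :=
  F.fold (· ⊓ ·) z x

section InfOver

variable {I L : Type*} [SemilatticeInf L]

theorem le_infOver_iff {x : I → L} {F : Finset I} {z c : L} :
    c ≤ infOver x F z ↔ c ≤ z ∧ ∀ i ∈ F, c ≤ x i :=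
  Finset.fold_op_rel_iff_and (r := (· ≤ ·)) le_inf_iff

theorem infOver_congr {x y : I → L} {F : Finset I} (h : ∀ i ∈ F, x i = y i) (z : L) :
    infOver x F z = infOver y F z :=
  Finset.fold_congr h

@[simp] theorem infOver_empty (x : I → L) (z : L) : infOver x ∅ z = z := rfl

theorem infOver_insert [DecidableEq I] (x : I → L) (F : Finset I) (i : I) (z : L) :
    infOver x (insert i F) z = infOver x F (x i ⊓ z) :=
  eq_of_forall_le_iff fun c => by
    simp only [le_infOver_iff, Finset.forall_mem_insert, le_inf_iff]; tauto

/-- A family of sets stable under preimages along translations is stable under preimages along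
finite infima. -/
theorem preimage_infOver_mem {𝒦 : Set (Set L)}
    (h𝒦 : ∀ K ∈ 𝒦, ∀ a : L, {z | a ⊓ z ∈ K} ∈ 𝒦) (x : I → L) (F : Finset I) {K : Set L}
    (hK : K ∈ 𝒦) : {z | infOver x F z ∈ K} ∈ 𝒦 := by
  classical
  induction F using Finset.induction_on with
  | empty => simpa using hK
  | insert i F _ ih =>
    simp only [infOver_insert]
    exact h𝒦 _ ih (x i)

end InfOver

/-- Every nonempty chain of `P` has an infimum and a supremum within `P`, which belong to each
member of `𝒦` containing the chain. -/
def ChainCompleteFor {L : Type*} [SemilatticeInf L] (P : Set L) (𝒦 : Set (Set L)) : Prop :=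
  ∀ C ⊆ P, C.Nonempty → IsChain (· ≤ ·) C →
    (∃ a, IsGLBWithin P C a ∧ ∀ K ∈ 𝒦, C ⊆ K → a ∈ K) ∧
    ∃ b, IsLUBWithin P C b ∧ ∀ K ∈ 𝒦, C ⊆ K → b ∈ K

section Abstract

variable {L : Type*} [SemilatticeInf L] {P : Set L} {𝒦 : Set (Set L)}

/-- If all finite infima of a nonempty family in `P` lie in members of `𝒮 ⊆ 𝒦`, then so does its
infimum within `P`. -/
theorem ChainCompleteFor.exists_isGLBWithin_range (hP : ∀ a ∈ P, ∀ b ∈ P, a ⊓ b ∈ P)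
    (hC : ChainCompleteFor P 𝒦) (h𝒦 : ∀ K ∈ 𝒦, ∀ a : L, {z | a ⊓ z ∈ K} ∈ 𝒦)
    {I : Type*} (x : I → L) (hx : ∀ i, x i ∈ P) (i₀ : I) {𝒮 : Set (Set L)} (h𝒮 : 𝒮 ⊆ 𝒦)
    (hfin : ∀ K ∈ 𝒮, ∀ F : Finset I, infOver x F (x i₀) ∈ K) :
    ∃ a, IsGLBWithin P (Set.range x) a ∧ ∀ K ∈ 𝒮, a ∈ K := by
  classical
  let S : Set L := {b | b ∈ P ∧ (∀ K ∈ 𝒮, ∀ F : Finset I, infOver x F b ∈ K) ∧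
    ∀ c ∈ P, (∀ i, c ≤ x i) → c ≤ b}
  obtain ⟨m, -, hmS, hmin⟩ : ∃ m : L, m ≤ x i₀ ∧ m ∈ S ∧ ∀ ⦃b⦄, b ∈ S → b ≤ m → m ≤ b :=
    @zorn_le_nonempty₀ Lᵒᵈ _ S (fun C hCS hch y hy => by
    obtain ⟨⟨a, ha, haK⟩, -⟩ := hC C (fun b hb => (hCS hb).1) ⟨y, hy⟩ hch.symm
    exact ⟨a, ⟨ha.1, fun K hK F => haK _ (preimage_infOver_mem h𝒦 x F (h𝒮 hK))
      fun b hb => (hCS hb).2.1 K hK F, fun c hc hcx => ha.2.2 c hc fun b hb =>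
        (hCS hb).2.2 c hc hcx⟩, fun b hb => ha.2.1 b hb⟩)
    (x i₀) ⟨hx i₀, hfin, fun c _ hc => hc i₀⟩
  have hle : ∀ i, m ≤ x i := fun i => by
    have hS : x i ⊓ m ∈ S := ⟨hP _ (hx i) _ hmS.1,
      fun K hK F => by simpa only [infOver_insert] using hmS.2.1 K hK (insert i F),
      fun c hc hcx => le_inf (hcx i) (hmS.2.2 c hc hcx)⟩
    exact (hmin hS inf_le_right).trans inf_le_left
  exact ⟨m, ⟨hmS.1, Set.forall_mem_range.2 hle,
    fun c hc hcx => hmS.2.2 c hc (Set.forall_mem_range.1 hcx)⟩,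
    fun K hK => by simpa using hmS.2.1 K hK ∅⟩

/-- Construction of a function by well-founded recursion, where the value at `β` is chosen subject
to a condition depending on the previous values. -/
theorem exists_forall_of_wellFounded {I M : Type*} [LinearOrder I] [WellFoundedLT I] [Nonempty M]
    (Q : I → (I → M) → M → Prop)
    (hcongr : ∀ β f g z, (∀ i < β, f i = g i) → Q β f z → Q β g z)
    (hex : ∀ β f, (∀ γ < β, Q γ f (f γ)) → ∃ z, Q β f z) :
    ∃ f : I → M, ∀ β, Q β f (f β) := by
  classical
  let m : M := Classical.arbitrary M
  let ext : (β : I) → ((γ : I) → γ < β → M) → I → M :=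
    fun β prev i => if h : i < β then prev i h else m
  let f : I → M := (wellFounded_lt (α := I)).fix fun β prev =>
    if h : ∃ z, Q β (ext β prev) z then h.choose else m
  refine ⟨f, fun β => ?_⟩
  induction β using (wellFounded_lt (α := I)).induction with
  | _ β ih =>
    have hext : ∀ i < β, ext β (fun γ _ => f γ) i = f i := fun i hi => dif_pos hi
    obtain ⟨z, hz⟩ := hex β f ih
    have h : ∃ z, Q β (ext β fun γ _ => f γ) z :=
      ⟨z, hcongr _ _ _ _ (fun i hi => (hext i hi).symm) hz⟩
    have hf : f β = h.choose := by
      refine ((wellFounded_lt (α := I)).fix_eq _ β).trans ?_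
      exact dif_pos h
    rw [hf]
    exact hcongr _ _ _ _ hext h.choose_spec

/-- Given sets `U i ⊆ K i` indexed by a well-ordered set, choose `x i ∈ P` recursively so that
finite infima stay in the sets `U i`; the supremum of the infima of tails lies in all `K i`. -/
theorem ChainCompleteFor.inter_iInter_nonempty (hP : ∀ a ∈ P, ∀ b ∈ P, a ⊓ b ∈ P)
    (hC : ChainCompleteFor P 𝒦) (h𝒦 : ∀ K ∈ 𝒦, ∀ a : L, {z | a ⊓ z ∈ K} ∈ 𝒦)
    {𝒪 : Set (Set L)} (h𝒪 : ∀ O ∈ 𝒪, ∀ a : L, {z | a ⊓ z ∈ O} ∈ 𝒪) (p : L)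
    {I : Type*} [LinearOrder I] [WellFoundedLT I] [Nonempty I]
    (hsmall : ∀ β : I, ∀ T ⊆ 𝒪, (∀ O ∈ T, p ∈ O) →
      (∃ g : Finset (Set.Iic β) × Set.Iic β × Bool → Set L, T ⊆ Set.range g) →
      (P ∩ ⋂₀ T).Nonempty)
    (U K : I → Set L) (hU : ∀ i, U i ∈ 𝒪) (hK : ∀ i, K i ∈ 𝒦) (hUK : ∀ i, U i ⊆ K i)
    (hp : ∀ i, p ∈ U i) : (P ∩ ⋂ i, K i).Nonempty := by
  classical
  let Q : I → (I → L) → L → Prop := fun β f z => z ∈ P ∧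
    ∀ F : Finset I, (∀ i ∈ F, i < β) → ∀ δ ≤ β, (∀ i ∈ F, δ ≤ i) →
      infOver f F z ∈ U δ ∧ infOver f F (p ⊓ z) ∈ U δ
  obtain ⟨x, hx⟩ : ∃ x : I → L, ∀ β, Q β x (x β) := by
    have : Nonempty L := ⟨p⟩
    refine exists_forall_of_wellFounded Q (fun β f g z hfg hQ => ⟨hQ.1, fun F hF δ hδ hFδ => ?_⟩)
      fun β f ih => ?_
    · have hc := infOver_congr fun i hi => hfg i (hF i hi)
      simpa only [hc] using hQ.2 F hF δ hδ hFδ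
    · have key : ∀ F : Finset I, (∀ i ∈ F, i < β) → ∀ δ, (∀ i ∈ F, δ ≤ i) →
          infOver f F p ∈ U δ := by
        intro F
        induction F using Finset.induction_on_max with
        | empty => exact fun _ δ _ => by simpa using hp δ
        | insert i F hi _ =>
          intro hF δ hδ
          rw [infOver_insert, inf_comm]
          exact ((ih i (hF i (by simp))).2 F hi δ (hδ i (by simp))
            fun j hj => hδ j (by simp [hj])).2
      let T : Set (Set L) := {O | ∃ F : Finset I, (∀ i ∈ F, i < β) ∧ ∃ δ ≤ β, (∀ i ∈ F, δ ≤ i) ∧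
        (O = {z | infOver f F z ∈ U δ} ∨ O = {z | infOver f F (p ⊓ z) ∈ U δ})}
      obtain ⟨z, hzP, hz⟩ := hsmall β T
        (by
          rintro O ⟨F, -, δ, -, -, rfl | rfl⟩
          · exact preimage_infOver_mem h𝒪 f F (hU δ)
          · exact h𝒪 _ (preimage_infOver_mem h𝒪 f F (hU δ)) p)
        (by
          rintro O ⟨F, hF, δ, -, hFδ, rfl | rfl⟩
          · exact key F hF δ hFδ
          · simpa using key F hF δ hFδ)
        ⟨fun t => bif t.2.2 then
            {z | infOver f (t.1.map (Function.Embedding.subtype _)) z ∈ U t.2.1}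
          else {z | infOver f (t.1.map (Function.Embedding.subtype _)) (p ⊓ z) ∈ U t.2.1}, by
          rintro O ⟨F, hF, δ, hδ, -, hO⟩
          have hmap : (F.subtype (· ∈ Set.Iic β)).map (Function.Embedding.subtype _) = F :=
            Finset.subtype_map_of_mem fun i hi => (hF i hi).le
          rcases hO with rfl | rfl
          · exact ⟨(F.subtype (· ∈ Set.Iic β), ⟨δ, hδ⟩, true), by simp only [hmap, cond_true]⟩
          · exact ⟨(F.subtype (· ∈ Set.Iic β), ⟨δ, hδ⟩, false), by simp only [hmap, cond_false]⟩⟩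
      exact ⟨z, hzP, fun F hF δ hδ hFδ => ⟨hz _ ⟨F, hF, δ, hδ, hFδ, .inl rfl⟩,
        hz _ ⟨F, hF, δ, hδ, hFδ, .inr rfl⟩⟩⟩
  have hfin : ∀ δ i, δ ≤ i → ∀ F : Finset I, (∀ j ∈ F, δ ≤ j) → infOver x F (x i) ∈ U δ := by
    intro δ i hi F hF
    have hne : (insert i F).Nonempty := Finset.insert_nonempty i F
    set m := (insert i F).max' hne
    have hmem : m ∈ insert i F := Finset.max'_mem _ _
    have hge : ∀ j ∈ insert i F, δ ≤ j := by simpa using ⟨hi, hF⟩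
    have heq : infOver x F (x i) = infOver x ((insert i F).erase m) (x m) := by
      refine eq_of_forall_le_iff fun c => ?_
      have h₁ : c ≤ infOver x F (x i) ↔ ∀ j ∈ insert i F, c ≤ x j := by
        rw [le_infOver_iff, Finset.forall_mem_insert]
      have h₂ : (c ≤ infOver x ((insert i F).erase m) (x m)) ↔ ∀ j ∈ insert i F, c ≤ x j := by
        rw [le_infOver_iff, ← Finset.forall_mem_insert (p := fun j => c ≤ x j),
          Finset.insert_erase hmem]
      rw [h₁, h₂]
    rw [heq]
    exact ((hx m).2 _ (fun j hj => lt_of_le_of_ne (Finset.le_max' _ _ (Finset.mem_of_mem_erase hj))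
      (Finset.ne_of_mem_erase hj)) δ (hge m hmem)
      fun j hj => hge j (Finset.mem_of_mem_erase hj)).1
  have hglb : ∀ α, ∃ a, IsGLBWithin P (Set.range fun i : Set.Ici α => x i) a ∧
      ∀ δ ≤ α, a ∈ K δ := by
    intro α
    obtain ⟨a, ha, haK⟩ := hC.exists_isGLBWithin_range hP h𝒦 (fun i : Set.Ici α => x i)
      (fun i => (hx i).1) ⟨α, le_rfl⟩ (𝒮 := K '' Set.Iic α)
      (by rintro _ ⟨δ, -, rfl⟩; exact hK δ) (by
        rintro _ ⟨δ, hδ, rfl⟩ F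
        have h := hfin δ α hδ (F.map (Function.Embedding.subtype _)) (by
          simp only [Finset.mem_map, Function.Embedding.subtype_apply]
          rintro _ ⟨j, -, rfl⟩
          exact le_trans hδ j.2)
        rw [infOver, Finset.fold_map] at h
        exact hUK δ h)
    exact ⟨a, ha, fun δ hδ => haK _ ⟨δ, hδ, rfl⟩⟩
  choose z hz hzK using hglb
  have hmono : Monotone z := fun α α' h => (hz α').2.2 _ (hz α).1 <| by
    rintro _ ⟨i, rfl⟩
    exact (hz α).2.1 _ ⟨⟨i, le_trans h i.2⟩, rfl⟩
  have hchain : ∀ s : Set I, IsChain (· ≤ ·) (z '' s) := by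
    rintro s _ ⟨i, -, rfl⟩ _ ⟨j, -, rfl⟩ -
    exact (le_total i j).imp (fun h => hmono h) fun h => hmono h
  have hsub : ∀ s : Set I, z '' s ⊆ P := by
    rintro s _ ⟨i, -, rfl⟩
    exact (hz i).1
  obtain ⟨-, s, hs, -⟩ := hC _ (hsub Set.univ) (Set.univ_nonempty.image z) (hchain _)
  refine ⟨s, hs.1, Set.mem_iInter.2 fun δ => ?_⟩
  obtain ⟨-, t, ht, htK⟩ := hC _ (hsub (Set.Ici δ)) (Set.nonempty_Ici.image z) (hchain _)
  have hts : t = s := le_antisymm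
    (ht.2.2 s hs.1 (by rintro _ ⟨i, -, rfl⟩; exact hs.2.1 _ ⟨i, trivial, rfl⟩))
    (hs.2.2 t ht.1 (by
      rintro _ ⟨i, -, rfl⟩
      exact (hmono (le_max_left i δ)).trans (ht.2.1 _ ⟨_, le_max_right i δ, rfl⟩)))
  rw [← hts]
  exact htK _ (hK δ) (by rintro _ ⟨i, hi, rfl⟩; exact hzK i δ hi)

end Abstract

section Topological

open Cardinal Topology

variable {L : Type*} [SemilatticeInf L] [TopologicalSpace L] {P : Set L} {𝒦 : Set (Set L)}

/-- The members of `𝒦` that contain, around each of their points, the intersection of countably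
many neighborhoods from `𝒦`. -/
def countablyOpenMembers (𝒦 : Set (Set L)) : Set (Set L) :=
  {O | O ∈ 𝒦 ∧ ∀ q ∈ O, ∃ 𝒰 : Set (Set L), 𝒰.Countable ∧ (∀ V ∈ 𝒰, V ∈ 𝒦 ∧ V ∈ 𝓝 q) ∧ ⋂₀ 𝒰 ⊆ O}

theorem preimage_inf_mem_countablyOpenMembers (hcont : ∀ a : L, Continuous fun z => a ⊓ z)
    (h𝒦 : ∀ K ∈ 𝒦, ∀ a : L, {z | a ⊓ z ∈ K} ∈ 𝒦) {O : Set L} (hO : O ∈ countablyOpenMembers 𝒦)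
    (a : L) : {z | a ⊓ z ∈ O} ∈ countablyOpenMembers 𝒦 := by
  refine ⟨h𝒦 O hO.1 a, fun q hq => ?_⟩
  obtain ⟨𝒰, hc, h𝒰, hsub⟩ := hO.2 _ hq
  refine ⟨(fun V => {z | a ⊓ z ∈ V}) '' 𝒰, hc.image _, ?_, fun z hz => hsub fun V hV =>
    hz _ ⟨V, hV, rfl⟩⟩
  rintro _ ⟨V, hV, rfl⟩
  exact ⟨h𝒦 V (h𝒰 V hV).1 a, (hcont a).continuousAt.preimage_mem_nhds (h𝒰 V hV).2⟩

/-- If `p ∈ closure P`, then `P` meets every intersection of countably many neighborhoods of `p`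
from `𝒦`. -/
theorem ChainCompleteFor.inter_sInter_nonempty_of_countable
    (hP : ∀ a ∈ P, ∀ b ∈ P, a ⊓ b ∈ P) (hC : ChainCompleteFor P 𝒦)
    (hcont : ∀ a : L, Continuous fun z => a ⊓ z)
    (h𝒦 : ∀ K ∈ 𝒦, ∀ a : L, {z | a ⊓ z ∈ K} ∈ 𝒦) {p : L} (hp : p ∈ closure P)
    {S : Set (Set L)} (hS : S.Countable) (hS𝒦 : S ⊆ 𝒦) (hSp : ∀ K ∈ S, K ∈ 𝓝 p) :
    (P ∩ ⋂₀ S).Nonempty := by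
  rcases S.eq_empty_or_nonempty with rfl | hne
  · simpa using closure_nonempty_iff.1 ⟨p, hp⟩
  obtain ⟨K, rfl⟩ := hS.exists_eq_range hne
  rw [Set.sInter_range]
  refine hC.inter_iInter_nonempty hP h𝒦 (𝒪 := {O | IsOpen O})
    (fun O hO a => hO.preimage (hcont a)) p ?_ (fun n => interior (K n)) K
    (fun n => isOpen_interior) (fun n => hS𝒦 ⟨n, rfl⟩) (fun n => interior_subset)
    (fun n => mem_interior_iff_mem_nhds.2 (hSp _ ⟨n, rfl⟩))
  rintro β T hT hTp ⟨g, hg⟩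
  have hfin : T.Finite := (Set.finite_range g).subset hg
  rw [Set.inter_comm]
  exact mem_closure_iff.1 hp _ (hfin.isOpen_sInter hT) hTp

theorem mk_finset_prod_lt_of_lt {J : Type*} {κ : Cardinal} (hκ : ℵ₀ ≤ κ) (hJ : #J < κ) :
    #(Finset J × J × Bool) < κ := by
  rcases finite_or_infinite J with h | h
  · exact (lt_aleph0_of_finite _).trans_le hκ
  · have hJ' : ℵ₀ ≤ #J := aleph0_le_mk J
    have hB : #(J × Bool) ≤ #J := by
      have : #(J × Bool) = #J * 2 := by simp
      rw [this]
      exact mul_le_of_le hJ' le_rfl ((natCast_le_aleph0 (n := 2)).trans hJ')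
    have : #(Finset J × J × Bool) = #J * #(J × Bool) := by
      rw [mk_prod, lift_id, lift_id, mk_finset_of_infinite]
    rw [this]
    exact (mul_le_of_le hJ' le_rfl hB).trans_lt hJ

/-- If `p ∈ closure P`, then `P` meets every intersection of countably open members of `𝒦` that
contain `p`. The proof is by induction on the cardinality of the family. -/
theorem ChainCompleteFor.inter_sInter_nonempty
    (hP : ∀ a ∈ P, ∀ b ∈ P, a ⊓ b ∈ P) (hC : ChainCompleteFor P 𝒦)
    (hcont : ∀ a : L, Continuous fun z => a ⊓ z)
    (h𝒦 : ∀ K ∈ 𝒦, ∀ a : L, {z | a ⊓ z ∈ K} ∈ 𝒦) {p : L} (hp : p ∈ closure P)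
    (S : Set (Set L)) (hS : S ⊆ countablyOpenMembers 𝒦) (hSp : ∀ O ∈ S, p ∈ O) :
    (P ∩ ⋂₀ S).Nonempty := by
  induction hκ : #S using WellFoundedLT.induction generalizing S with
  | _ κ ih =>
  subst hκ
  by_cases hcount : S.Countable
  · choose! 𝒰 h𝒰c h𝒰 hsub using fun O (hO : O ∈ S) => (hS hO).2 p (hSp O hO)
    obtain ⟨z, hzP, hz⟩ := hC.inter_sInter_nonempty_of_countable hP hcont h𝒦 hp
      (S := ⋃ O ∈ S, 𝒰 O) (hcount.biUnion h𝒰c)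
      (Set.iUnion₂_subset fun O hO V hV => (h𝒰 O hO V hV).1)
      (by
        intro V hV
        obtain ⟨O, hO, hV⟩ := Set.mem_iUnion₂.1 hV
        exact (h𝒰 O hO V hV).2)
    exact ⟨z, hzP, fun O hO => hsub O hO fun V hV => hz V (Set.mem_biUnion hO hV)⟩
  · have hinf : ℵ₀ ≤ #S := by
      rw [← le_aleph0_iff_set_countable, not_le] at hcount
      exact hcount.le
    obtain ⟨I, ⟨e⟩⟩ : ∃ I : Type _, Nonempty (I ≃ S) := ⟨S, ⟨Equiv.refl _⟩⟩
    have hI : #I = #S := mk_congr e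
    obtain ⟨_, _, hord⟩ := exists_ord_eq_type_lt I
    have : Nonempty I := mk_ne_zero_iff.1 (hI ▸ aleph0_pos.trans_le hinf).ne'
    rw [Set.sInter_eq_iInter, ← e.surjective.iInter_comp]
    refine hC.inter_iInter_nonempty hP h𝒦 (𝒪 := countablyOpenMembers 𝒦)
      (fun O hO a => preimage_inf_mem_countablyOpenMembers hcont h𝒦 hO a) p ?_
      (fun i => (e i : Set L)) (fun i => (e i : Set L)) (fun i => hS (e i).2)
      (fun i => (hS (e i).2).1) (fun _ => subset_rfl) (fun i => hSp _ (e i).2)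
    rintro β T hT hTp ⟨g, hg⟩
    have hIic : #(Set.Iic β) < #S := by
      rw [← Set.Iio_insert]
      exact mk_insert_le.trans_lt (add_lt_of_lt hinf (hI ▸ mk_Iio_lt β hord)
        (one_lt_aleph0.trans_le hinf))
    exact ih _ (((mk_le_mk_of_subset hg).trans mk_range_le).trans_lt
      (mk_finset_prod_lt_of_lt hinf hIic)) T hT hTp rfl

end Topological

section T2Delta

open Topology

/-- In a `T_{2δ}`-space, inside every open neighborhood of `x` there is a closed set containing `x`
which contains, around each of its points, a countable intersection of closed neighborhoods. -/
theorem IsT2Delta.exists_isClosed_subset {Y : Type*} [TopologicalSpace Y] (hY : IsT2Delta Y)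
    {U : Set Y} (hU : IsOpen U) {x : Y} (hx : x ∈ U) :
    ∃ G ⊆ U, x ∈ G ∧ IsClosed G ∧ ∀ q ∈ G, ∃ 𝒰 : Set (Set Y), 𝒰.Countable ∧
      (∀ V ∈ 𝒰, IsClosed V ∧ V ∈ 𝓝 q) ∧ ⋂₀ 𝒰 ⊆ G := by
  have hseq : ∀ W : Set Y, IsOpen W ∧ x ∈ W →
      ∃ f : ℕ → Set Y, (∀ n, IsClosed (f n) ∧ f n ∈ 𝓝 x) ∧ ⋂ n, f n ⊆ W := by
    rintro W ⟨hW, hxW⟩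
    obtain ⟨𝒰, hc, h𝒰, hsub⟩ := hY.2 W hW x hxW
    obtain ⟨f, hf⟩ := (hc.insert Set.univ).exists_eq_range (Set.insert_nonempty _ _)
    refine ⟨f, fun n => ?_, ?_⟩
    · rcases (hf ▸ Set.mem_range_self n : f n ∈ insert Set.univ 𝒰) with h | h
      · rw [h]; exact ⟨isClosed_univ, Filter.univ_mem⟩
      · exact h𝒰 _ h
    · rw [← Set.sInter_range, ← hf]
      exact (Set.sInter_subset_sInter (Set.subset_insert _ _)).trans hsub
  choose! f hf hfsub using hseq
  let W : List ℕ → Set Y := fun l => l.foldr (fun n V => interior (f V n)) U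
  have hW : ∀ l, IsOpen (W l) ∧ x ∈ W l := by
    intro l
    induction l with
    | nil => exact ⟨hU, hx⟩
    | cons n l ih => exact ⟨isOpen_interior, mem_interior_iff_mem_nhds.2 (hf _ ih n).2⟩
  have hG : ⋂ l, W l = ⋂ l, ⋂ n, f (W l) n :=
    (Set.subset_iInter₂ fun l n => (Set.iInter_subset W (n :: l)).trans interior_subset).antisymm
      (Set.iInter_mono fun l => hfsub _ (hW l))
  refine ⟨⋂ l, W l, Set.iInter_subset W [], Set.mem_iInter.2 fun l => (hW l).2, ?_, fun q hq => ?_⟩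
  · rw [hG]
    exact isClosed_iInter fun l => isClosed_iInter fun n => (hf _ (hW l) n).1
  · choose 𝒰 hc h𝒰 hsub using fun l => hY.2 (W l) (hW l).1 q (Set.mem_iInter.1 hq l)
    refine ⟨⋃ l, 𝒰 l, Set.countable_iUnion hc, fun V hV => ?_, fun z hz => ?_⟩
    · obtain ⟨l, hV⟩ := Set.mem_iUnion.1 hV
      exact h𝒰 l V hV
    · exact Set.mem_iInter.2 fun l => hsub l fun V hV => hz V (Set.mem_iUnion.2 ⟨l, hV⟩)

end T2Delta

section Product

variable {Y : Type*} [TopologicalSpace Y]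

/-- The closed subsets of `Y × Y` depending on one coordinate only. -/
def closedCylinders (Y : Type*) [TopologicalSpace Y] : Set (Set (Y × Y)) :=
  {K | ∃ G : Set Y, IsClosed G ∧ (K = Prod.fst ⁻¹' G ∨ K = Prod.snd ⁻¹' G)}

theorem preimage_mem_countablyOpenMembers_closedCylinders [SemilatticeInf Y] {π : Y × Y → Y}
    (hπ : π = Prod.fst ∨ π = Prod.snd) {G : Set Y} (hG : IsClosed G)
    (hGδ : ∀ q ∈ G, ∃ 𝒰 : Set (Set Y), 𝒰.Countable ∧
      (∀ V ∈ 𝒰, IsClosed V ∧ V ∈ nhds q) ∧ ⋂₀ 𝒰 ⊆ G) :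
    π ⁻¹' G ∈ countablyOpenMembers (closedCylinders Y) := by
  have hcyl : ∀ V : Set Y, IsClosed V → π ⁻¹' V ∈ closedCylinders Y := fun V hV =>
    ⟨V, hV, hπ.imp (fun h => by rw [h]) fun h => by rw [h]⟩
  have hcont : Continuous π := by
    rcases hπ with rfl | rfl
    exacts [continuous_fst, continuous_snd]
  refine ⟨hcyl G hG, fun q hq => ?_⟩
  obtain ⟨𝒰, hc, h𝒰, hsub⟩ := hGδ _ hq
  refine ⟨(π ⁻¹' ·) '' 𝒰, hc.image _, ?_, fun z hz => hsub fun V hV => hz _ ⟨V, hV, rfl⟩⟩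
  rintro _ ⟨V, hV, rfl⟩
  exact ⟨hcyl V (h𝒰 V hV).1, hcont.continuousAt.preimage_mem_nhds (h𝒰 V hV).2⟩

/-- The order of a complete subsemilattice is chain complete as a subset of the square. -/
theorem IsCompleteSubSemilattice.chainCompleteFor_order [SemilatticeInf Y] {X : Set Y}
    (hX : IsCompleteSubSemilattice X) :
    ChainCompleteFor {p : Y × Y | p.1 ∈ X ∧ p.2 ∈ X ∧ p.1 ⊓ p.2 = p.1} (closedCylinders Y) := by
  intro C hCP hne hC
  have h₁ := hX (Prod.fst '' C) (by rintro _ ⟨c, hc, rfl⟩; exact (hCP hc).1) (hne.image _)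
    (monotone_fst.isChain_image hC)
  have h₂ := hX (Prod.snd '' C) (by rintro _ ⟨c, hc, rfl⟩; exact (hCP hc).2.1) (hne.image _)
    (monotone_snd.isChain_image hC)
  have hmem : ∀ a b, a ∈ closure (Prod.fst '' C) → b ∈ closure (Prod.snd '' C) →
      ∀ K ∈ closedCylinders Y, C ⊆ K → (a, b) ∈ K := by
    rintro a b ha hb _ ⟨G, hG, rfl | rfl⟩ hCK
    · exact closure_minimal (Set.image_subset_iff.2 hCK) hG ha
    · exact closure_minimal (Set.image_subset_iff.2 hCK) hG hb
  constructor
  · obtain ⟨⟨a, hac, ha⟩, -⟩ := h₁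
    obtain ⟨⟨b, hbc, hb⟩, -⟩ := h₂
    refine ⟨(a, b), ⟨⟨ha.1, hb.1, inf_eq_left.2 (hb.2.2 a ha.1 ?_)⟩, fun c hc =>
      ⟨ha.2.1 _ ⟨c, hc, rfl⟩, hb.2.1 _ ⟨c, hc, rfl⟩⟩, fun q hq hqC => ⟨ha.2.2 _ hq.1 ?_,
      hb.2.2 _ hq.2.1 ?_⟩⟩, hmem a b hac hbc⟩
    · rintro _ ⟨c, hc, rfl⟩
      exact (ha.2.1 _ ⟨c, hc, rfl⟩).trans (inf_eq_left.1 (hCP hc).2.2)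
    · rintro _ ⟨c, hc, rfl⟩
      exact (hqC c hc).1
    · rintro _ ⟨c, hc, rfl⟩
      exact (hqC c hc).2
  · obtain ⟨-, a, hac, ha⟩ := h₁
    obtain ⟨-, b, hbc, hb⟩ := h₂
    refine ⟨(a, b), ⟨⟨ha.1, hb.1, inf_eq_left.2 (ha.2.2 b hb.1 ?_)⟩, fun c hc =>
      ⟨ha.2.1 _ ⟨c, hc, rfl⟩, hb.2.1 _ ⟨c, hc, rfl⟩⟩, fun q hq hqC => ⟨ha.2.2 _ hq.1 ?_,
      hb.2.2 _ hq.2.1 ?_⟩⟩, hmem a b hac hbc⟩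
    · rintro _ ⟨c, hc, rfl⟩
      exact (inf_eq_left.1 (hCP hc).2.2).trans (hb.2.1 _ ⟨c, hc, rfl⟩)
    · rintro _ ⟨c, hc, rfl⟩
      exact (hqC c hc).1
    · rintro _ ⟨c, hc, rfl⟩
      exact (hqC c hc).2

end Product

/-- for a complete subsemilattice `X` of a semitopological semilattice `Y`
satisfying `T_{2δ}`, the partial order of `X` is closed in `Y × Y`. -/
theorem stmt5 {Y : Type*} [SemilatticeInf Y] [TopologicalSpace Y]
    (hsemi : ∀ a : Y, Continuous fun y => a ⊓ y)
    (hY : IsT2Delta Y)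
    (X : Set Y) (hsub : ∀ a ∈ X, ∀ b ∈ X, a ⊓ b ∈ X)
    (hX : IsCompleteSubSemilattice X) :
    IsClosed {p : Y × Y | p.1 ∈ X ∧ p.2 ∈ X ∧ p.1 ⊓ p.2 = p.1} := by

  have hT1 := hY.1
  refine isClosed_of_closure_subset fun p hp => ?_
  let S : Set (Set (Y × Y)) := {O | O ∈ countablyOpenMembers (closedCylinders Y) ∧ p ∈ O}
  have hP : ∀ a ∈ {p : Y × Y | p.1 ∈ X ∧ p.2 ∈ X ∧ p.1 ⊓ p.2 = p.1},
      ∀ b ∈ {p : Y × Y | p.1 ∈ X ∧ p.2 ∈ X ∧ p.1 ⊓ p.2 = p.1},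
        a ⊓ b ∈ {p : Y × Y | p.1 ∈ X ∧ p.2 ∈ X ∧ p.1 ⊓ p.2 = p.1} := fun a ha b hb =>
    ⟨hsub _ ha.1 _ hb.1, hsub _ ha.2.1 _ hb.2.1,
      inf_eq_left.2 (inf_le_inf (inf_eq_left.1 ha.2.2) (inf_eq_left.1 hb.2.2))⟩
  obtain ⟨q, hqP, hq⟩ := hX.chainCompleteFor_order.inter_sInter_nonempty hP
    (fun a => ((hsemi a.1).comp continuous_fst).prodMk ((hsemi a.2).comp continuous_snd))
    (by
      rintro _ ⟨G, hG, rfl | rfl⟩ a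
      · exact ⟨_, hG.preimage (hsemi a.1), .inl rfl⟩
      · exact ⟨_, hG.preimage (hsemi a.2), .inr rfl⟩)
    hp S (fun _ h => h.1) (fun _ h => h.2)
  have heq : ∀ π : Y × Y → Y, π = Prod.fst ∨ π = Prod.snd → π q = π p := by
    intro π hπ
    by_contra hne
    obtain ⟨G, hGU, hpG, hGc, hGδ⟩ :=
      hY.exists_isClosed_subset (isOpen_compl_singleton (x := π q)) (x := π p) (Ne.symm hne)
    exact hGU (hq _ ⟨preimage_mem_countablyOpenMembers_closedCylinders hπ hGc hGδ, hpG⟩) rfl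
  rwa [← Prod.ext (heq _ (.inl rfl)) (heq _ (.inr rfl))]
end

section
/- Let Y be a semitopological semilattice and let X ⊆ Y be a subsemilattice (a subset closed under the operation ⊓) that is complete in the subspace topology. Let x, y ∈ Y be points such that for every neighborhood O_x of x and every neighborhood O_y of y there exist points x' ∈ O_x ∩ X and y' ∈ O_y ∩ X with x' ⊓ y' = x'. Then for any countable families 𝒰 and 𝒱 of closed neighborhoods of x and of y, respectively, there exist points x' ∈ X ∩ ⋂𝒰 and y' ∈ X ∩ ⋂𝒱 such that x' ⊓ y' = x'. -/
open Set Filter Topology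

/-- In a semitopological semilattice, near a point `z` of the closure of a subsemilattice `R`
there is a double sequence `P` in `R`, monotone in `n` and decreasing in `m > n`, such that `P m n`
stays in a prescribed open neighborhood `W n` of `z`. -/
theorem exists_meets_mem_of_mem_closure {Z : Type*} [SemilatticeInf Z] [TopologicalSpace Z]
    (hsemi : ∀ a : Z, Continuous fun b => a ⊓ b) {R : Set Z} (hR : InfClosed R) {z : Z}
    (hz : z ∈ closure R) {W : ℕ → Set Z} (hWo : ∀ n, IsOpen (W n)) (hW : ∀ n, z ∈ W n) :
    ∃ P : ℕ → ℕ → Z, (∀ m, ∀ n < m, P m n ∈ R ∩ W n) ∧ (∀ m, Monotone (P m)) ∧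
      ∀ m, ∀ n < m, P (m + 1) n ≤ P m n := by
  let Inv : ℕ → (ℕ → Z) → Prop := fun m p =>
    Monotone p ∧ ∀ n < m, p n ∈ R ∧ p n ∈ W n ∧ p n ⊓ z ∈ W n
  have step : ∀ m p, Inv m p → ∃ q, Inv (m + 1) q ∧ ∀ n < m, q n ≤ p n := by
    rintro m p ⟨hmono, hp⟩
    have near : ∀ c n, c ⊓ z ∈ W n → ∀ᶠ a in 𝓝 z, c ⊓ a ∈ W n := fun c n h =>
      (hsemi c).continuousAt.eventually_mem ((hWo n).mem_nhds h)
    have hev : ∀ᶠ a in 𝓝 z, (a ∈ W m ∧ z ⊓ a ∈ W m) ∧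
        ∀ n ∈ Iio m, p n ⊓ a ∈ W n ∧ (p n ⊓ z) ⊓ a ∈ W n := by
      refine (((hWo m).eventually_mem (hW m)).and (near z m (by simpa using hW m))).and ?_
      refine (eventually_all_finite (finite_Iio m)).2 fun n hn => ?_
      obtain ⟨-, -, h⟩ := hp n hn
      exact (near _ _ h).and (near _ _ (by simpa [inf_assoc] using h))
    obtain ⟨a, haR, ⟨ha, hza⟩, hpa⟩ :=
      ((mem_closure_iff_frequently.1 hz).and_eventually hev).exists
    refine ⟨fun n => if n < m then p n ⊓ a else a, ⟨?_, ?_⟩, ?_⟩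
    · intro i j hij
      dsimp only
      split_ifs with hi hj
      · exact inf_le_inf_right _ (hmono hij)
      · exact inf_le_right
      · omega
      · exact le_rfl
    · intro n hn
      dsimp only
      split_ifs with h
      · refine ⟨hR (hp n h).1 haR, (hpa n h).1, ?_⟩
        rw [inf_right_comm]
        exact (hpa n h).2
      · obtain rfl : n = m := by omega
        exact ⟨haR, ha, by rwa [inf_comm]⟩
    · intro n hn
      simp [hn]
  choose! f hf hle using step
  let P : ℕ → ℕ → Z := fun m => Nat.rec (fun _ => z) f m
  have hP : ∀ m, Inv m (P m) := by
    intro m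
    induction m with
    | zero => exact ⟨monotone_const, by simp⟩
    | succ m ih => exact hf m _ ih
  exact ⟨P, fun m n h => ⟨((hP m).2 n h).1, ((hP m).2 n h).2.1⟩, fun m => (hP m).1,
    fun m => hle m _ (hP m)⟩

/-- In a complete subsemilattice, a double sequence `P`, monotone in `n` and decreasing in
`m > n`, with `P m n ∈ U n` for a decreasing sequence of closed sets `U n`, has its lower limit
in all the sets `U n`. -/
theorem IsCompleteSubSemilattice.exists_liminf_mem {Y : Type*} [SemilatticeInf Y]
    [TopologicalSpace Y] {X : Set Y} (hX : IsCompleteSubSemilattice X) {U : ℕ → Set Y}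
    (hUc : ∀ n, IsClosed (U n)) (hU : Antitone U) {P : ℕ → ℕ → Y}
    (hP : ∀ m, ∀ n < m, P m n ∈ X ∩ U n) (hmono : ∀ m, Monotone (P m))
    (hanti : ∀ m, ∀ n < m, P (m + 1) n ≤ P m n) :
    ∃ (i : ℕ → Y) (s : Y), (∀ n, IsGLBWithin X ((P · n) '' Ioi n) (i n)) ∧
      IsLUBWithin X (range i) s ∧ ∀ n, s ∈ U n := by
  have hanti' : ∀ n, AntitoneOn (P · n) (Ioi n) := by
    intro n a ha b _ hab
    induction b, hab using Nat.le_induction with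
    | base => exact le_rfl
    | succ b hab ih =>
      have hb : n < b := lt_of_lt_of_le ha hab
      exact (hanti b n hb).trans (ih hb)
  have hglb : ∀ n, ∃ a ∈ U n, IsGLBWithin X ((P · n) '' Ioi n) a := by
    intro n
    obtain ⟨⟨a, hac, ha⟩, -⟩ := hX ((P · n) '' Ioi n)
      (image_subset_iff.2 fun m hm => (hP m n hm).1) (nonempty_Ioi.image _) (by
        rintro _ ⟨a, ha, rfl⟩ _ ⟨b, hb, rfl⟩ -
        exact (le_total a b).symm.imp (hanti' n hb ha) (hanti' n ha hb))
    exact ⟨a, closure_minimal (image_subset_iff.2 fun m hm => (hP m n hm).2) (hUc n) hac, ha⟩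
  choose i hiU hi using hglb
  have himono : Monotone i := by
    refine monotone_nat_of_le_succ fun n => (hi (n + 1)).2.2 _ (hi n).1 ?_
    rintro _ ⟨m, hm, rfl⟩
    have hm' : n < m := (Nat.lt_succ_self n).trans hm
    exact ((hi n).2.1 _ ⟨m, hm', rfl⟩).trans (hmono m n.le_succ)
  have hlub : ∀ k, ∃ s ∈ U k, IsLUBWithin X (range i) s := by
    intro k
    obtain ⟨-, s, hsc, hs⟩ := hX (i '' Ici k)
      (image_subset_iff.2 fun n _ => (hi n).1) (nonempty_Ici.image _)
      (himono.isChain_range.mono (image_subset_range _ _))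
    have hsub : i '' Ici k ⊆ U k := image_subset_iff.2 fun n hn => hU hn (hiU n)
    refine ⟨s, closure_minimal hsub (hUc k) hsc, hs.1, ?_, fun b hb h => hs.2.2 b hb fun c hc => h c (image_subset_range _ _ hc)⟩
    rintro _ ⟨n, rfl⟩
    exact (himono (le_max_left n k)).trans (hs.2.1 _ ⟨_, le_max_right n k, rfl⟩)
  obtain ⟨s, -, hs⟩ := hlub 0
  refine ⟨i, s, hi, hs, fun n => ?_⟩
  obtain ⟨t, htU, ht⟩ := hlub n
  rwa [le_antisymm (hs.2.2 t ht.1 ht.2.1) (ht.2.2 s hs.1 hs.2.1)]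

/-- A countable family of closed neighborhoods can be replaced by a decreasing sequence. -/
theorem exists_antitone_seq_closed_nhds {Y : Type*} [TopologicalSpace Y] {x : Y}
    {𝒰 : Set (Set Y)} (hc : 𝒰.Countable) (h𝒰 : ∀ U ∈ 𝒰, IsClosed U ∧ U ∈ 𝓝 x) :
    ∃ U : ℕ → Set Y, (∀ n, IsClosed (U n)) ∧ (∀ n, U n ∈ 𝓝 x) ∧ Antitone U ∧
      ⋂ n, U n ⊆ ⋂₀ 𝒰 := by
  obtain ⟨u, hu⟩ := (hc.insert univ).exists_eq_range (insert_nonempty _ _)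
  have hu' : ∀ n, IsClosed (u n) ∧ u n ∈ 𝓝 x := by
    intro n
    have hn : u n ∈ insert univ 𝒰 := hu ▸ mem_range_self n
    rcases hn with h | h
    · rw [h]
      exact ⟨isClosed_univ, univ_mem⟩
    · exact h𝒰 _ h
  refine ⟨fun n => ⋂ k ∈ Iic n, u k, fun n => isClosed_biInter fun k _ => (hu' k).1,
    fun n => (biInter_mem (finite_Iic n)).2 fun k _ => (hu' k).2,
    fun a b hab => biInter_subset_biInter_left (Iic_subset_Iic.2 hab), fun a ha V hV => ?_⟩
  obtain ⟨n, rfl⟩ : V ∈ range u := hu ▸ mem_insert_of_mem _ hV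
  exact mem_iInter₂.1 (mem_iInter.1 ha n) n self_mem_Iic

/-- countable families of closed neighborhoods version. -/
theorem stmt7 {Y : Type*} [SemilatticeInf Y] [TopologicalSpace Y]
    (hsemi : ∀ a : Y, Continuous fun y => a ⊓ y)
    (X : Set Y) (hsub : ∀ a ∈ X, ∀ b ∈ X, a ⊓ b ∈ X)
    (hX : IsCompleteSubSemilattice X)
    (x y : Y)
    (hxy : ∀ Ox ∈ nhds x, ∀ Oy ∈ nhds y, ∃ x' ∈ Ox ∩ X, ∃ y' ∈ Oy ∩ X, x' ⊓ y' = x')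
    (𝒰 𝒱 : Set (Set Y)) (h𝒰c : 𝒰.Countable) (h𝒱c : 𝒱.Countable)
    (h𝒰 : ∀ U ∈ 𝒰, IsClosed U ∧ U ∈ nhds x)
    (h𝒱 : ∀ V ∈ 𝒱, IsClosed V ∧ V ∈ nhds y) :
    ∃ x' ∈ X ∩ ⋂₀ 𝒰, ∃ y' ∈ X ∩ ⋂₀ 𝒱, x' ⊓ y' = x' := by
  obtain ⟨U, hUc, hUx, hU, hU𝒰⟩ := exists_antitone_seq_closed_nhds h𝒰c h𝒰
  obtain ⟨V, hVc, hVy, hV, hV𝒱⟩ := exists_antitone_seq_closed_nhds h𝒱c h𝒱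
  let R : Set (Y × Y) := {p | p.1 ∈ X ∧ p.2 ∈ X ∧ p.1 ≤ p.2}
  have hR : InfClosed R := fun p hp q hq =>
    ⟨hsub _ hp.1 _ hq.1, hsub _ hp.2.1 _ hq.2.1, inf_le_inf hp.2.2 hq.2.2⟩
  have hz : (x, y) ∈ closure R := by
    refine mem_closure_iff_nhds.2 fun O hO => ?_
    obtain ⟨Ox, hOx, Oy, hOy, hsubO⟩ := mem_nhds_prod_iff.1 hO
    obtain ⟨a, ha, b, hb, hab⟩ := hxy Ox hOx Oy hOy
    exact ⟨(a, b), hsubO ⟨ha.1, hb.1⟩, ha.2, hb.2, inf_eq_left.1 hab⟩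
  obtain ⟨P, hP, hmono, hanti⟩ := exists_meets_mem_of_mem_closure
    (fun p : Y × Y => ((hsemi p.1).comp continuous_fst).prodMk ((hsemi p.2).comp continuous_snd))
    hR hz (W := fun n => interior (U n) ×ˢ interior (V n))
    (fun n => isOpen_interior.prod isOpen_interior)
    (fun n => ⟨mem_interior_iff_mem_nhds.2 (hUx n), mem_interior_iff_mem_nhds.2 (hVy n)⟩)
  obtain ⟨i, s, hi, hs, hsU⟩ := hX.exists_liminf_mem hUc hU (P := fun m n => (P m n).1)
    (fun m n h => ⟨(hP m n h).1.1, interior_subset (hP m n h).2.1⟩)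
    (fun m _ _ h => (hmono m h).1) (fun m n h => (hanti m n h).1)
  obtain ⟨j, t, hj, ht, htV⟩ := hX.exists_liminf_mem hVc hV (P := fun m n => (P m n).2)
    (fun m n h => ⟨(hP m n h).1.2.1, interior_subset (hP m n h).2.2⟩)
    (fun m _ _ h => (hmono m h).2) (fun m n h => (hanti m n h).2)
  have hij : ∀ n, i n ≤ j n := by
    refine fun n => (hj n).2.2 _ (hi n).1 ?_
    rintro _ ⟨m, hm, rfl⟩
    exact ((hi n).2.1 _ ⟨m, hm, rfl⟩).trans (hP m n hm).1.2.2
  refine ⟨s, ⟨hs.1, hU𝒰 (mem_iInter.2 hsU)⟩, t, ⟨ht.1, hV𝒱 (mem_iInter.2 htV)⟩,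
    inf_eq_left.2 (hs.2.2 t ht.1 ?_)⟩
  rintro _ ⟨n, rfl⟩
  exact (hij n).trans (ht.2.1 _ (mem_range_self n))
end
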